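/- arXiv:2101.04698 — 2 statements merged into one kernel-verified Lean document; each statement's English description precedes it below -/
import Mathlib

section
/- For every ε > 0 there exist n0 ∈ ℕ and η > 0 such that the following holds: for any n ≥ n0, if H is an n-vertex linear hypergraph with maximum degree at most ηn and no edge e ∈ H satisfies η√n < |e| < √n/η, then the chromatic index of H is at most εn. -/
open Finset
open scoped Classical

/-- A hypergraph on vertex set `Fin n` is *linear* if any two distinct edges intersect in at
most one vertex. -/
def LinearHG {n : ℕ} (H : Finset (Finset (Fin n))) : Prop :=
  ∀ e ∈ H, ∀ f ∈ H, e ≠ f → (e ∩ f).card ≤ 1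

/-- `φ` is a proper edge-colouring of the hypergraph `H`. -/
def IsProperEC {n : ℕ} (H : Finset (Finset (Fin n))) (φ : Finset (Fin n) → ℕ) : Prop :=
  ∀ e ∈ H, ∀ f ∈ H, e ≠ f → (e ∩ f).Nonempty → φ e ≠ φ f

/-- The chromatic index of the hypergraph `H` is at most `k`. -/
def ChromIndexLE {n : ℕ} (H : Finset (Finset (Fin n))) (k : ℕ) : Prop :=
  ∃ φ : Finset (Fin n) → ℕ, (∀ e ∈ H, φ e < k) ∧ IsProperEC H φ

/-- The degree of a vertex `v` in the hypergraph `H`. -/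
def degHG {n : ℕ} (H : Finset (Finset (Fin n))) (v : Fin n) : ℕ :=
  (H.filter fun e => v ∈ e).card

section HardCore

variable {α : Type*} [DecidableEq α] (G : SimpleGraph α)

/-- The independent sets of `G` contained in `A`. -/
noncomputable def indepSets (A : Finset α) : Finset (Finset α) :=
  A.powerset.filter fun I => G.IsIndepSet (I : Set α)

/-- The independence polynomial of `G[A]` evaluated at `l`. -/
noncomputable def indepPoly (l : ℝ) (A : Finset α) : ℝ :=
  ∑ I ∈ indepSets G A, l ^ #I

/-- The vertices of `A` outside the closed neighbourhood of `x`. -/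
noncomputable def awayFrom (A : Finset α) (x : α) : Finset α :=
  A.filter fun y => y ≠ x ∧ ¬ G.Adj x y

variable {G}

lemma mem_indepSets {A I : Finset α} :
    I ∈ indepSets G A ↔ I ⊆ A ∧ ∀ x ∈ I, ∀ y ∈ I, ¬ G.Adj x y := by
  rw [indepSets, mem_filter, mem_powerset]
  constructor
  · rintro ⟨hA, h⟩
    exact ⟨hA, fun x hx y hy hxy => h hx hy hxy.ne hxy⟩
  · rintro ⟨hA, h⟩
    exact ⟨hA, fun x hx y hy _ => h x hx y hy⟩

lemma empty_mem_indepSets (A : Finset α) : ∅ ∈ indepSets G A := by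
  simp [mem_indepSets]

lemma indepSets_mono {A B : Finset α} (h : A ⊆ B) : indepSets G A ⊆ indepSets G B := by
  intro I hI
  rw [mem_indepSets] at hI ⊢
  exact ⟨hI.1.trans h, hI.2⟩

lemma mem_awayFrom {A : Finset α} {x y : α} :
    y ∈ awayFrom G A x ↔ y ∈ A ∧ y ≠ x ∧ ¬ G.Adj x y := by
  simp [awayFrom]

lemma indepPoly_mono {l : ℝ} (hl : 0 ≤ l) {A B : Finset α} (h : A ⊆ B) :
    indepPoly G l A ≤ indepPoly G l B :=
  sum_le_sum_of_subset_of_nonneg (indepSets_mono h) fun _ _ _ => pow_nonneg hl _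

lemma one_le_indepPoly {l : ℝ} (hl : 0 ≤ l) (A : Finset α) : 1 ≤ indepPoly G l A := by
  have := single_le_sum (f := fun I : Finset α => l ^ #I) (fun _ _ => pow_nonneg hl _)
    (empty_mem_indepSets (G := G) A)
  simpa [indepPoly] using this

lemma sum_indepSets_mem (l : ℝ) {A : Finset α} {x : α} (hx : x ∈ A) :
    ∑ I ∈ indepSets G A with x ∈ I, l ^ #I = l * indepPoly G l (awayFrom G A x) := by
  rw [indepPoly, mul_sum]
  refine sum_nbij' (fun I => I.erase x) (fun I => insert x I) ?_ ?_ ?_ ?_ ?_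
  · intro I hI
    simp only [mem_filter, mem_indepSets] at hI ⊢
    refine ⟨fun y hy => ?_, fun y hy z hz => hI.1.2 y (mem_of_mem_erase hy) z (mem_of_mem_erase hz)⟩
    rw [mem_erase] at hy
    exact mem_awayFrom.2 ⟨hI.1.1 hy.2, hy.1, hI.1.2 x hI.2 y hy.2⟩
  · intro I hI
    simp only [mem_filter, mem_indepSets] at hI ⊢
    have h1 : ∀ y ∈ I, y ∈ A ∧ y ≠ x ∧ ¬ G.Adj x y := fun y hy => mem_awayFrom.1 (hI.1 hy)
    refine ⟨⟨?_, ?_⟩, mem_insert_self _ _⟩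
    · exact insert_subset hx fun y hy => (h1 y hy).1
    · intro y hy z hz hyz
      rw [mem_insert] at hy hz
      rcases hy with rfl | hy <;> rcases hz with rfl | hz
      · exact G.irrefl hyz
      · exact (h1 z hz).2.2 hyz
      · exact (h1 y hy).2.2 hyz.symm
      · exact hI.2 y hy z hz hyz
  · intro I hI
    simp only [mem_filter] at hI
    exact insert_erase hI.2
  · intro I hI
    rw [mem_indepSets] at hI
    exact erase_insert fun h => (mem_awayFrom.1 (hI.1 h)).2.1 rfl
  · intro I hI
    simp only [mem_filter] at hI
    rw [← card_erase_add_one hI.2, pow_succ, mul_comm]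

lemma indepPoly_le_erase {l : ℝ} (hl : 0 ≤ l) (A : Finset α) (x : α) :
    indepPoly G l A ≤ (1 + l) * indepPoly G l (A.erase x) := by
  by_cases hx : x ∈ A
  · have h1 : indepPoly G l A = ∑ I ∈ indepSets G A with x ∈ I, l ^ #I
        + ∑ I ∈ indepSets G A with x ∉ I, l ^ #I := (sum_filter_add_sum_filter_not _ _ _).symm
    have h2 : ∑ I ∈ indepSets G A with x ∉ I, l ^ #I ≤ indepPoly G l (A.erase x) := by
      refine sum_le_sum_of_subset_of_nonneg ?_ fun _ _ _ => pow_nonneg hl _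
      intro I hI
      simp only [mem_filter, mem_indepSets] at hI ⊢
      exact ⟨subset_erase.2 ⟨hI.1.1, hI.2⟩, hI.1.2⟩
    have h3 : indepPoly G l (awayFrom G A x) ≤ indepPoly G l (A.erase x) := by
      refine indepPoly_mono hl fun y hy => ?_
      rw [mem_awayFrom] at hy
      exact mem_erase.2 ⟨hy.2.1, hy.1⟩
    rw [h1, sum_indepSets_mem l hx]
    nlinarith
  · rw [erase_eq_of_notMem hx]
    nlinarith [one_le_indepPoly (G := G) hl A]

lemma indepPoly_le_sdiff {l : ℝ} (hl : 0 ≤ l) (A B : Finset α) :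
    indepPoly G l A ≤ (1 + l) ^ #B * indepPoly G l (A \ B) := by
  induction B using Finset.induction_on with
  | empty => simp
  | insert x B hx ih =>
    rw [card_insert_of_notMem hx, sdiff_insert, pow_succ, mul_assoc]
    exact ih.trans (mul_le_mul_of_nonneg_left (indepPoly_le_erase hl _ _) (by positivity))

lemma indepPoly_le_pow {l : ℝ} (hl : 0 ≤ l) (A : Finset α) :
    indepPoly G l A ≤ (1 + l) ^ #A := by
  have := indepPoly_le_sdiff (G := G) hl A A
  have h2 : indepPoly G l (∅ : Finset α) = 1 := by
    have h : indepSets G (∅ : Finset α) = {∅} := by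
      ext I; simp [mem_indepSets]; rintro rfl; simp
    simp [indepPoly, h]
  simpa [h2] using this

lemma sum_card_inter_mul_pow (l : ℝ) (A B : Finset α) :
    ∑ I ∈ indepSets G A, (#(I ∩ B) : ℝ) * l ^ #I
      = ∑ y ∈ B, ∑ I ∈ indepSets G A with y ∈ I, l ^ #I := by
  simp_rw [sum_filter]
  rw [sum_comm]
  refine sum_congr rfl fun I _ => ?_
  rw [← sum_filter, sum_const, nsmul_eq_mul, filter_mem_eq_inter, inter_comm]

lemma half_card_mul_indepPoly_le {l : ℝ} (hl : 0 ≤ l) {F : Finset α}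
    (hF : ∀ y ∈ F, (1 + l) ^ (#(F.filter (G.Adj y)) + 1) ≤ 2) :
    l * #F * indepPoly G l F / 2 ≤ ∑ J ∈ indepSets G F, (#J : ℝ) * l ^ #J := by
  have h1 : ∑ J ∈ indepSets G F, (#J : ℝ) * l ^ #J
      = ∑ y ∈ F, l * indepPoly G l (awayFrom G F y) := by
    rw [← sum_congr rfl fun y hy => sum_indepSets_mem (G := G) l hy, ← sum_card_inter_mul_pow]
    refine sum_congr rfl fun J hJ => ?_
    rw [inter_eq_left.2 (mem_indepSets.1 hJ).1]
  have h2 : ∀ y ∈ F, l * (indepPoly G l F / 2) ≤ l * indepPoly G l (awayFrom G F y) := by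
    intro y hy
    refine mul_le_mul_of_nonneg_left ?_ hl
    have h3 := indepPoly_le_sdiff (G := G) hl F (insert y (F.filter (G.Adj y)))
    have h4 : F \ insert y (F.filter (G.Adj y)) = awayFrom G F y := by
      ext z; simp only [mem_sdiff, mem_insert, mem_filter, mem_awayFrom]; tauto
    have h5 : #(insert y (F.filter (G.Adj y))) = #(F.filter (G.Adj y)) + 1 :=
      card_insert_of_notMem (by simp)
    rw [h4, h5] at h3
    have := mul_le_mul_of_nonneg_right (hF y hy)
      (zero_le_one.trans (one_le_indepPoly (G := G) hl (awayFrom G F y)))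
    linarith
  rw [h1]
  calc l * #F * indepPoly G l F / 2 = ∑ y ∈ F, l * (indepPoly G l F / 2) := by
        rw [sum_const, nsmul_eq_mul]; ring
    _ ≤ _ := sum_le_sum h2

lemma occupancy_in_neighbourhood {l τ D : ℝ} (hl : 0 ≤ l) (hl1 : l ≤ 1) (hτ : 0 ≤ τ)
    (hD : 2 * τ * Real.exp (4 * τ) ≤ l * D) {F : Finset α}
    (hF : ∀ y ∈ F, (1 + l) ^ (#(F.filter (G.Adj y)) + 1) ≤ 2) :
    τ * (l + indepPoly G l F) ≤ l * D + ∑ J ∈ indepSets G F, (#J : ℝ) * l ^ #J := by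
  have h1 := half_card_mul_indepPoly_le hl hF
  have hZ := one_le_indepPoly (G := G) hl F
  by_cases h : 4 * τ ≤ l * #F
  · have : 0 ≤ l * D := le_trans (by positivity) hD
    nlinarith [mul_le_mul_of_nonneg_right h (zero_le_one.trans hZ)]
  · have h2 : indepPoly G l F ≤ Real.exp (4 * τ) := by
      refine (indepPoly_le_pow hl F).trans ?_
      calc (1 + l) ^ #F ≤ (Real.exp l) ^ #F := by
            gcongr; rw [add_comm]; exact Real.add_one_le_exp l
        _ = Real.exp (l * #F) := by rw [← Real.exp_nat_mul, mul_comm]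
        _ ≤ _ := Real.exp_le_exp.2 (le_of_not_ge h)
    have h3 : 0 ≤ l * #F * indepPoly G l F / 2 := by positivity
    nlinarith [mul_le_mul_of_nonneg_left h2 hτ]

/-- Local occupancy of the hard-core model in a locally sparse graph. -/
lemma local_occupancy {l τ D : ℝ} (hl : 0 ≤ l) (hl1 : l ≤ 1) (hτ : 0 ≤ τ)
    (hD : 2 * τ * Real.exp (4 * τ) ≤ l * D) {A : Finset α} {x : α} (hx : x ∈ A)
    (hA : ∀ y ∈ A, G.Adj x y → (1 + l) ^ (#(A.filter fun z => G.Adj x z ∧ G.Adj y z) + 1) ≤ 2) :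
    τ * indepPoly G l A ≤
      D * ∑ I ∈ indepSets G A with x ∈ I, l ^ #I
        + ∑ y ∈ A with G.Adj x y, ∑ I ∈ indepSets G A with y ∈ I, l ^ #I := by
  set f : Finset α → ℝ := fun I =>
    l ^ #I * (D * (if x ∈ I then 1 else 0) + #(I ∩ A.filter (G.Adj x)) - τ) with hf
  suffices h : 0 ≤ ∑ I ∈ indepSets G A, f I by
    rw [← sum_card_inter_mul_pow, sum_filter, indepPoly, mul_sum, mul_sum, ← sum_add_distrib,
      ← sub_nonneg, ← sum_sub_distrib]
    refine h.trans_eq (sum_congr rfl fun I _ => ?_)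
    simp only [hf]
    split_ifs <;> ring
  have hmaps : ∀ I ∈ indepSets G A, I.filter (fun y => y ≠ x ∧ ¬ G.Adj x y)
      ∈ indepSets G (awayFrom G A x) := by
    intro I hI
    rw [mem_indepSets] at hI ⊢
    refine ⟨filter_subset_filter _ hI.1, fun y hy z hz => hI.2 y ?_ z ?_⟩
    · exact (mem_filter.1 hy).1
    · exact (mem_filter.1 hz).1
  rw [← sum_fiberwise_of_maps_to hmaps]
  refine sum_nonneg fun S hS => ?_
  rw [mem_indepSets] at hS
  have hSx : ∀ y ∈ S, y ∈ A ∧ y ≠ x ∧ ¬ G.Adj x y := fun y hy => mem_awayFrom.1 (hS.1 hy)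
  have hxS : x ∉ S := fun h => (hSx x h).2.1 rfl
  set F : Finset α := A.filter fun y => G.Adj x y ∧ ∀ z ∈ S, ¬ G.Adj y z with hFdef
  have hFx : ∀ y ∈ F, y ∈ A ∧ G.Adj x y ∧ ∀ z ∈ S, ¬ G.Adj y z := fun y hy => by
    simpa [hFdef] using hy
  have hdisj : ∀ J ∈ indepSets G F, Disjoint S J := by
    intro J hJ
    rw [disjoint_left]
    exact fun y hy hyJ => (hSx y hy).2.2 (hFx y ((mem_indepSets.1 hJ).1 hyJ)).2.1
  have hfib : (indepSets G A).filter
      (fun I => I.filter (fun y => y ≠ x ∧ ¬ G.Adj x y) = S)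
      = insert (insert x S) ((indepSets G F).image fun J => S ∪ J) := by
    ext I
    simp only [mem_filter, mem_insert, mem_image, mem_indepSets]
    constructor
    · rintro ⟨⟨hIA, hI⟩, hIS⟩
      by_cases hxI : x ∈ I
      · left
        ext y
        rw [← hIS]
        simp only [mem_insert, mem_filter]
        constructor
        · intro hy
          by_cases hyx : y = x
          · exact Or.inl hyx
          · exact Or.inr ⟨hy, hyx, hI x hxI y hy⟩
        · rintro (rfl | hy)
          · exact hxI
          · exact hy.1
      · right
        refine ⟨I.filter (G.Adj x), ⟨fun y hy => ?_, fun y hy z hz =>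
          hI y (mem_filter.1 hy).1 z (mem_filter.1 hz).1⟩, ?_⟩
        · rw [mem_filter] at hy
          refine mem_filter.2 ⟨hIA hy.1, hy.2, fun z hz => hI y hy.1 z ?_⟩
          rw [← hIS] at hz
          exact (mem_filter.1 hz).1
        · ext y
          rw [← hIS]
          simp only [mem_union, mem_filter]
          have : y ∈ I → y ≠ x := fun h h' => hxI (h' ▸ h)
          tauto
    · rintro (rfl | ⟨J, ⟨hJF, hJ⟩, rfl⟩)
      · refine ⟨⟨insert_subset hx fun y hy => (hSx y hy).1, ?_⟩, ?_⟩
        · intro y hy z hz hyz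
          rw [mem_insert] at hy hz
          rcases hy with rfl | hy <;> rcases hz with rfl | hz
          · exact G.irrefl hyz
          · exact (hSx z hz).2.2 hyz
          · exact (hSx y hy).2.2 hyz.symm
          · exact hS.2 y hy z hz hyz
        · ext y
          simp only [mem_filter, mem_insert]
          have := hSx y
          tauto
      · refine ⟨⟨union_subset (fun y hy => (hSx y hy).1) fun y hy => (hFx y (hJF hy)).1, ?_⟩, ?_⟩
        · intro y hy z hz hyz
          rw [mem_union] at hy hz
          rcases hy with hy | hy <;> rcases hz with hz | hz
          · exact hS.2 y hy z hz hyz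
          · exact (hFx z (hJF hz)).2.2 y hy hyz.symm
          · exact (hFx y (hJF hy)).2.2 z hz hyz
          · exact hJ y hy z hz hyz
        · ext y
          simp only [mem_filter, mem_union]
          have := hSx y
          have h' : y ∈ J → G.Adj x y := fun h => (hFx y (hJF h)).2.1
          tauto
  rw [hfib, sum_insert, sum_image]
  · have hfx : l ^ #S * (l * D - l * τ) ≤ f (insert x S) := by
      simp only [hf, mem_insert_self, if_true]
      rw [card_insert_of_notMem hxS, pow_succ]
      have : (0 : ℝ) ≤ #(insert x S ∩ A.filter (G.Adj x)) := Nat.cast_nonneg _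
      have h2 : 0 ≤ l ^ #S * l := by positivity
      nlinarith [mul_nonneg h2 this]
    have hfJ : ∀ J ∈ indepSets G F, f (S ∪ J) = l ^ #S * ((#J : ℝ) * l ^ #J - τ * l ^ #J) := by
      intro J hJ
      have hJF := (mem_indepSets.1 hJ).1
      have h1 : x ∉ S ∪ J := by
        rw [mem_union, not_or]
        exact ⟨hxS, fun h => G.irrefl (hFx x (hJF h)).2.1⟩
      have h2 : (S ∪ J) ∩ A.filter (G.Adj x) = J := by
        ext y
        simp only [mem_inter, mem_union, mem_filter]
        have := hSx y
        have h' : y ∈ J → y ∈ A ∧ G.Adj x y := fun h => ⟨(hFx y (hJF h)).1, (hFx y (hJF h)).2.1⟩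
        tauto
      simp only [hf, h1, h2, if_false]
      rw [card_union_of_disjoint (hdisj J hJ), pow_add]
      ring
    rw [sum_congr rfl hfJ, ← mul_sum, sum_sub_distrib, ← mul_sum]
    have hocc := occupancy_in_neighbourhood (G := G) hl hl1 hτ hD (F := F) (by
      intro y hy
      refine le_trans ?_ (hA y (hFx y hy).1 (hFx y hy).2.1)
      refine pow_le_pow_right₀ (by linarith) (Nat.add_le_add_right (card_le_card ?_) 1)
      intro z hz
      rw [mem_filter] at hz ⊢
      exact ⟨(hFx z hz.1).1, (hFx z hz.1).2.1, hz.2⟩)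
    rw [indepPoly] at hocc
    have h2 : 0 ≤ l ^ #S := by positivity
    nlinarith [mul_le_mul_of_nonneg_left hocc h2]
  · intro J hJ J' hJ' h
    have h1 := hdisj J hJ
    have h2 := hdisj J' hJ'
    simp only at h
    rw [← union_sdiff_cancel_left h1, h, union_sdiff_cancel_left h2]
  · rw [mem_image]
    rintro ⟨J, hJ, h⟩
    have h1 : x ∈ S ∪ J := h ▸ mem_insert_self x S
    rcases mem_union.1 h1 with h1 | h1
    · exact hxS h1
    · exact G.irrefl (hFx x ((mem_indepSets.1 hJ).1 h1)).2.1

end HardCore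

section IterativeColouring

lemma sum_mul_exp_sub_le {ι : Type*} {s : Finset ι} {w u : ι → ℝ} {a b : ℝ}
    (hw : ∀ i ∈ s, 0 ≤ w i) (hw1 : ∑ i ∈ s, w i = 1) (hu0 : ∀ i ∈ s, 0 ≤ u i)
    (hu1 : ∀ i ∈ s, u i ≤ 1) (hab : b - (∑ i ∈ s, w i * u i) / 2 ≤ a) :
    ∑ i ∈ s, w i * Real.exp (b - u i) ≤ Real.exp a := by
  have hexp : ∀ t : ℝ, 0 ≤ t → t ≤ 1 → Real.exp (-t) ≤ 1 - t / 2 := by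
    intro t ht0 ht1
    have h1 := Real.add_one_le_exp t
    rw [Real.exp_neg, inv_le_comm₀ (Real.exp_pos _) (by linarith)]
    refine le_trans ?_ h1
    rw [inv_le_iff_one_le_mul₀ (by linarith)]
    nlinarith
  have h1 : ∑ i ∈ s, w i * Real.exp (b - u i)
      ≤ Real.exp b * (1 - (∑ i ∈ s, w i * u i) / 2) := by
    calc ∑ i ∈ s, w i * Real.exp (b - u i)
        ≤ ∑ i ∈ s, Real.exp b * (w i - w i * u i / 2) := by
          refine sum_le_sum fun i hi => ?_
          rw [sub_eq_add_neg, Real.exp_add]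
          have h2 := mul_le_mul_of_nonneg_left (hexp _ (hu0 i hi) (hu1 i hi))
            (mul_nonneg (hw i hi) (Real.exp_pos b).le)
          linarith
      _ = _ := by rw [← mul_sum, sum_sub_distrib, hw1, sum_div]
  refine h1.trans (le_trans ?_ (Real.exp_le_exp.2 hab))
  rw [sub_eq_add_neg b, Real.exp_add]
  have h3 := Real.add_one_le_exp (-((∑ i ∈ s, w i * u i) / 2))
  exact mul_le_mul_of_nonneg_left (by linarith) (Real.exp_pos b).le

variable {α : Type*} [DecidableEq α]

lemma sum_indepSets_mul_sum {G : SimpleGraph α} (w : Finset α → ℝ) (g : α → ℝ) {A V : Finset α}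
    (hAV : A ⊆ V) (Q : α → Prop) :
    ∑ I ∈ indepSets G A, w I * ∑ y ∈ I with Q y, g y
      = ∑ y ∈ V with Q y, (∑ I ∈ indepSets G A with y ∈ I, w I) * g y := by
  have h : ∀ y, (∑ I ∈ indepSets G A with y ∈ I, w I) * g y
      = ∑ I ∈ indepSets G A, if y ∈ I then w I * g y else 0 := fun y => by
    rw [sum_mul, sum_filter]
  simp_rw [h]
  rw [sum_comm]
  refine sum_congr rfl fun I hI => ?_
  have hIV : I ⊆ V := (mem_indepSets.1 hI).1.trans hAV
  rw [← sum_filter, mul_sum]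
  refine sum_congr ?_ fun _ _ => rfl
  ext y
  have := @hIV y
  simp only [mem_filter]
  tauto

variable (G : SimpleGraph α)

/-- The quantity kept from growing while the colour classes are chosen: `U` is the set of
uncoloured vertices, `P x` the total probability with which `x` was offered a colour so far, and
`S v` the total of the offers made to neighbours of `v`. -/
noncomputable def potential (V : Finset α) (D J M : ℝ) (U : Finset α) (P S : α → ℝ) : ℝ :=
  ∑ v ∈ V, (Real.exp (J⁻¹ * (S v / 2 - #((V \ U).filter (G.Adj v))))
    + Real.exp ((J * M)⁻¹ * (∑ x ∈ U with G.Adj v x, (1 + P x / 2) - D)))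

variable {G}

lemma exists_colour_class {V U A : Finset α} {l τ D J M : ℝ} {P : α → ℝ} (S : α → ℝ)
    (hl : 0 < l) (hl1 : l ≤ 1) (hτ : 0 ≤ τ) (hD : 2 * τ * Real.exp (4 * τ) ≤ l * D)
    (hcod : ∀ x ∈ V, ∀ y ∈ V, G.Adj x y →
      (1 + l) ^ (#(V.filter fun z => G.Adj x z ∧ G.Adj y z) + 1) ≤ 2)
    (hJ0 : 0 < J) (hJ : ∀ v ∈ V, ∀ I ∈ indepSets G V, (#(I.filter (G.Adj v)) : ℝ) ≤ J)
    (hUV : U ⊆ V) (hAU : A ⊆ U) (hP : ∀ x, 0 ≤ P x) (hM1 : 1 ≤ M)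
    (hM : ∀ x, 1 + (P x + l) / 2 ≤ M) :
    ∃ I ∈ indepSets G A, ∃ p : α → ℝ, (∀ x, 0 ≤ p x) ∧ (∀ x, p x ≤ l) ∧
      (∀ x ∈ A, τ ≤ D * p x + ∑ y ∈ V with G.Adj x y, p y) ∧
      potential G V D J M (U \ I) (fun x => P x + p x)
        (fun v => S v + ∑ y ∈ V with G.Adj v y, p y) ≤ potential G V D J M U P S := by
  have hAV := hAU.trans hUV
  have hZ : 0 < indepPoly G l A := zero_lt_one.trans_le (one_le_indepPoly hl.le A)
  set w : Finset α → ℝ := fun I => l ^ #I / indepPoly G l A with hw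
  have hw0 : ∀ I, 0 < w I := fun I => by positivity
  have hw1 : ∑ I ∈ indepSets G A, w I = 1 := by
    rw [hw, ← sum_div]
    exact div_self hZ.ne'
  set p : α → ℝ := fun x => ∑ I ∈ indepSets G A with x ∈ I, w I with hp
  have hp' : ∀ x, p x = (∑ I ∈ indepSets G A with x ∈ I, l ^ #I) / indepPoly G l A := fun x => by
    rw [hp, sum_div]
  have hp0 : ∀ x, 0 ≤ p x := fun x => sum_nonneg fun I _ => (hw0 I).le
  have hpl : ∀ x, p x ≤ l := by
    intro x
    by_cases hx : x ∈ A
    · rw [hp', sum_indepSets_mem l hx, div_le_iff₀ hZ]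
      exact mul_le_mul_of_nonneg_left (indepPoly_mono hl.le (filter_subset _ _)) hl.le
    · have : (indepSets G A).filter (fun I => x ∈ I) = ∅ := by
        rw [filter_eq_empty_iff]
        exact fun I hI hxI => hx ((mem_indepSets.1 hI).1 hxI)
      rw [hp', this]
      simpa using hl.le
  have hocc : ∀ x ∈ A, τ ≤ D * p x + ∑ y ∈ V with G.Adj x y, p y := by
    intro x hx
    have h1 := local_occupancy (G := G) hl.le hl1 hτ hD hx fun y hy hxy => by
      refine le_trans (pow_le_pow_right₀ (by linarith) (Nat.add_le_add_right (card_le_card ?_) 1))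
        (hcod x (hAV hx) y (hAV hy) hxy)
      exact filter_subset_filter _ hAV
    have h2 : ∑ y ∈ A with G.Adj x y, p y ≤ ∑ y ∈ V with G.Adj x y, p y :=
      sum_le_sum_of_subset_of_nonneg (filter_subset_filter _ hAV) fun y _ _ => hp0 y
    refine le_trans ?_ (add_le_add_right h2 _)
    simp_rw [hp']
    rw [← sum_div, ← mul_div_assoc, ← add_div, le_div_iff₀ hZ]
    exact h1
  have havg : ∑ I ∈ indepSets G A, w I * potential G V D J M (U \ I) (fun x => P x + p x)
        (fun v => S v + ∑ y ∈ V with G.Adj v y, p y)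
      ≤ ∑ I ∈ indepSets G A, w I * potential G V D J M U P S := by
    rw [← sum_mul, hw1, one_mul]
    simp_rw [potential, mul_sum]
    rw [sum_comm]
    refine sum_le_sum fun v hv => ?_
    simp_rw [mul_add]
    rw [sum_add_distrib]
    have hIJ : ∀ I ∈ indepSets G A, (#(I.filter (G.Adj v)) : ℝ) ≤ J := fun I hI =>
      hJ v hv I (indepSets_mono hAV hI)
    refine add_le_add ?_ ?_
    · have h1 : ∀ I ∈ indepSets G A,
          J⁻¹ * ((S v + ∑ y ∈ V with G.Adj v y, p y) / 2 - #((V \ (U \ I)).filter (G.Adj v)))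
          = J⁻¹ * ((S v + ∑ y ∈ V with G.Adj v y, p y) / 2 - #((V \ U).filter (G.Adj v)))
            - ∑ y ∈ I with G.Adj v y, J⁻¹ := by
        intro I hI
        have hIU := (mem_indepSets.1 hI).1.trans hAU
        have h2 : (V \ (U \ I)).filter (G.Adj v)
            = (V \ U).filter (G.Adj v) ∪ I.filter (G.Adj v) := by
          ext y
          have := @hIU y
          have := @hUV y
          simp only [mem_filter, mem_sdiff, mem_union]
          tauto
        have h3 : Disjoint ((V \ U).filter (G.Adj v)) (I.filter (G.Adj v)) := by
          rw [disjoint_left]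
          intro y hy hy'
          simp only [mem_filter, mem_sdiff] at hy hy'
          exact hy.1.2 (hIU hy'.1)
        rw [h2, card_union_of_disjoint h3, sum_const, nsmul_eq_mul]
        push_cast
        ring
      rw [sum_congr rfl fun I hI => by rw [h1 I hI]]
      refine sum_mul_exp_sub_le (fun I _ => (hw0 I).le) hw1 ?_ ?_ ?_
      · exact fun I _ => sum_nonneg fun _ _ => (inv_pos.2 hJ0).le
      · intro I hI
        rw [sum_const, nsmul_eq_mul, ← div_eq_mul_inv, div_le_one hJ0]
        exact hIJ I hI
      · rw [sum_indepSets_mul_sum w (fun _ => J⁻¹) hAV, ← sum_mul]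
        refine le_of_eq ?_
        ring
    · have hJM : 0 < J * M := mul_pos hJ0 (by linarith)
      have hpos : ∀ y, 0 ≤ 1 + (P y + p y) / 2 := fun y => by linarith [hP y, hp0 y]
      have h1 : ∀ I ∈ indepSets G A,
          (J * M)⁻¹ * (∑ x ∈ U \ I with G.Adj v x, (1 + (P x + p x) / 2) - D)
          = (J * M)⁻¹ * (∑ x ∈ U with G.Adj v x, (1 + (P x + p x) / 2) - D)
            - ∑ y ∈ I with G.Adj v y, (J * M)⁻¹ * (1 + (P y + p y) / 2) := by
        intro I hI
        have hIU := (mem_indepSets.1 hI).1.trans hAU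
        have h2 : (U \ I).filter (G.Adj v) = U.filter (G.Adj v) \ I.filter (G.Adj v) := by
          ext y
          simp only [mem_filter, mem_sdiff]
          tauto
        rw [h2, ← mul_sum, ← sum_sdiff (filter_subset_filter (G.Adj v) hIU)]
        ring
      rw [sum_congr rfl fun I hI => by rw [h1 I hI]]
      refine sum_mul_exp_sub_le (fun I _ => (hw0 I).le) hw1 ?_ ?_ ?_
      · exact fun I _ => sum_nonneg fun y _ => mul_nonneg (inv_pos.2 hJM).le (hpos y)
      · intro I hI
        calc ∑ y ∈ I with G.Adj v y, (J * M)⁻¹ * (1 + (P y + p y) / 2)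
            ≤ ∑ y ∈ I with G.Adj v y, (J * M)⁻¹ * M := by
              refine sum_le_sum fun y _ => mul_le_mul_of_nonneg_left ?_ (inv_pos.2 hJM).le
              linarith [hM y, hpl y]
          _ = #(I.filter (G.Adj v)) / J := by
              rw [sum_const, nsmul_eq_mul]
              have : M ≠ 0 := by linarith
              field_simp
          _ ≤ 1 := by
              rw [div_le_one hJ0]
              exact hIJ I hI
      · rw [sum_indepSets_mul_sum w (fun y => (J * M)⁻¹ * (1 + (P y + p y) / 2)) hAV]
        have h2 : ∑ y ∈ U with G.Adj v y, p y
            ≤ ∑ y ∈ V with G.Adj v y, p y * (1 + (P y + p y) / 2) := by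
          calc ∑ y ∈ U with G.Adj v y, p y
              ≤ ∑ y ∈ V with G.Adj v y, p y :=
                sum_le_sum_of_subset_of_nonneg (filter_subset_filter _ hUV) fun y _ _ => hp0 y
            _ ≤ _ := sum_le_sum fun y _ => by nlinarith [hP y, hp0 y]
        have h3 : ∑ y ∈ V with G.Adj v y, p y * ((J * M)⁻¹ * (1 + (P y + p y) / 2))
            = (J * M)⁻¹ * ∑ y ∈ V with G.Adj v y, p y * (1 + (P y + p y) / 2) := by
          rw [mul_sum]
          exact sum_congr rfl fun y _ => by ring
        have h4 : ∑ x ∈ U with G.Adj v x, (1 + (P x + p x) / 2)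
            = ∑ x ∈ U with G.Adj v x, (1 + P x / 2) + (∑ y ∈ U with G.Adj v y, p y) / 2 := by
          rw [sum_div, ← sum_add_distrib]
          exact sum_congr rfl fun y _ => by ring
        change _ - (∑ y ∈ V with G.Adj v y, p y * ((J * M)⁻¹ * (1 + (P y + p y) / 2))) / 2 ≤ _
        rw [h3, h4]
        have := mul_le_mul_of_nonneg_left h2 (inv_pos.2 hJM).le
        linarith
  obtain ⟨I, hI, hle⟩ := exists_le_of_sum_le ⟨∅, empty_mem_indepSets A⟩ havg
  exact ⟨I, hI, p, hp0, hpl, hocc, le_of_mul_le_mul_left hle (hw0 I)⟩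

lemma exists_colouring_state {V : Finset α} {l τ D J M : ℝ} {T : ℕ} (L : α → ℕ → Prop)
    (hl : 0 < l) (hl1 : l ≤ 1) (hτ : 0 ≤ τ) (hD : 2 * τ * Real.exp (4 * τ) ≤ l * D)
    (hcod : ∀ x ∈ V, ∀ y ∈ V, G.Adj x y →
      (1 + l) ^ (#(V.filter fun z => G.Adj x z ∧ G.Adj y z) + 1) ≤ 2)
    (hdeg : ∀ v ∈ V, (#(V.filter (G.Adj v)) : ℝ) ≤ D)
    (hJ0 : 0 < J) (hJ : ∀ v ∈ V, ∀ I ∈ indepSets G V, (#(I.filter (G.Adj v)) : ℝ) ≤ J)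
    (hM : 1 + T * l / 2 ≤ M) (hM1 : 1 ≤ M) {c : ℕ} (hc : c ≤ T) :
    ∃ U ⊆ V, ∃ (φ : α → ℕ) (P S : α → ℝ),
      (∀ x ∈ V, x ∉ U → φ x < c ∧ L x (φ x)) ∧
      (∀ x ∈ V, x ∉ U → ∀ y ∈ V, y ∉ U → G.Adj x y → φ x ≠ φ y) ∧
      (∀ x, 0 ≤ P x ∧ P x ≤ c * l) ∧
      (∀ x ∈ U, τ * #((range c).filter (L x)) ≤ D * P x + S x) ∧
      potential G V D J M U P S ≤ 2 * #V := by
  induction c with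
  | zero =>
    refine ⟨V, Subset.rfl, fun _ => 0, fun _ => 0, fun _ => 0, ?_, ?_, ?_, ?_, ?_⟩
    · exact fun x hx hx' => absurd hx hx'
    · exact fun x hx hx' => absurd hx hx'
    · simp
    · simp
    · have : ∀ v ∈ V, (Real.exp (J⁻¹ * ((0 : ℝ) / 2 - #((V \ V).filter (G.Adj v))))
          + Real.exp ((J * M)⁻¹ * (∑ x ∈ V with G.Adj v x, (1 + (0 : ℝ) / 2) - D))) ≤ 2 := by
        intro v hv
        have h1 : Real.exp (J⁻¹ * ((0 : ℝ) / 2 - #((V \ V).filter (G.Adj v)))) ≤ 1 := by simp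
        have h2 : Real.exp ((J * M)⁻¹ * (∑ x ∈ V with G.Adj v x, (1 + (0 : ℝ) / 2) - D)) ≤ 1 := by
          rw [Real.exp_le_one_iff]
          refine mul_nonpos_of_nonneg_of_nonpos (by positivity) ?_
          simpa using hdeg v hv
        linarith
      refine (sum_le_sum this).trans_eq ?_
      rw [sum_const, nsmul_eq_mul, mul_comm]
  | succ c ih =>
    obtain ⟨U, hUV, φ, P, S, hφ, hprop, hP, hocc, hpot⟩ := ih (Nat.le_of_succ_le hc)
    have hcT : ((c : ℝ) + 1) * l ≤ T * l :=
      mul_le_mul_of_nonneg_right (by exact_mod_cast hc) hl.le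
    obtain ⟨I, hI, p, hp0, hpl, hpocc, hpot'⟩ := exists_colour_class (U := U)
      (A := U.filter fun x => L x c) S hl hl1 hτ hD hcod hJ0 hJ hUV (filter_subset _ _)
      (fun x => (hP x).1) hM1 (fun x => by linarith [(hP x).2] : ∀ x, 1 + (P x + l) / 2 ≤ M)
    rw [mem_indepSets] at hI
    have hIU : ∀ x ∈ I, x ∈ U ∧ L x c := fun x hx => mem_filter.1 (hI.1 hx)
    refine ⟨U \ I, sdiff_subset.trans hUV, fun x => if x ∈ I then c else φ x, _, _, ?_, ?_, ?_, ?_,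
      hpot'.trans hpot⟩
    · intro x hx hx'
      by_cases hxI : x ∈ I
      · simp only [hxI, if_true]
        exact ⟨Nat.lt_succ_self c, (hIU x hxI).2⟩
      · simp only [hxI, if_false]
        have := hφ x hx fun h => hx' (mem_sdiff.2 ⟨h, hxI⟩)
        exact ⟨this.1.trans (Nat.lt_succ_self c), this.2⟩
    · intro x hx hx' y hy hy' hxy
      by_cases hxI : x ∈ I <;> by_cases hyI : y ∈ I <;> simp only [hxI, hyI, if_true, if_false]
      · exact absurd hxy (hI.2 x hxI y hyI)
      · exact (hφ y hy fun h => hy' (mem_sdiff.2 ⟨h, hyI⟩)).1.ne'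
      · exact (hφ x hx fun h => hx' (mem_sdiff.2 ⟨h, hxI⟩)).1.ne
      · exact hprop x hx (fun h => hx' (mem_sdiff.2 ⟨h, hxI⟩)) y hy
          (fun h => hy' (mem_sdiff.2 ⟨h, hyI⟩)) hxy
    · intro x
      have := hP x
      push_cast
      exact ⟨by linarith [hp0 x], by linarith [hpl x]⟩
    · intro x hx
      rw [mem_sdiff] at hx
      have h1 := hocc x hx.1
      have h3 : 0 ≤ ∑ y ∈ V with G.Adj x y, p y := sum_nonneg fun y _ => hp0 y
      have hD0 : 0 ≤ D := (Nat.cast_nonneg _).trans (hdeg x (hUV hx.1))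
      have h4 := mul_nonneg hD0 (hp0 x)
      rw [range_add_one, filter_insert]
      split_ifs with h
      · rw [card_insert_of_notMem (by simp)]
        have := hpocc x (mem_filter.2 ⟨hx.1, h⟩)
        push_cast
        linarith
      · linarith

/-- A locally sparse graph has a partial list colouring from few colours that leaves only few
uncoloured neighbours at each vertex. -/
lemma exists_partial_colouring {V : Finset α} {l τ D J M T₀ : ℝ} {T : ℕ} (L : α → ℕ → Prop)
    (hl : 0 < l) (hl1 : l ≤ 1) (hτ : 0 ≤ τ) (hD : 2 * τ * Real.exp (4 * τ) ≤ l * D) (hD0 : 0 < D)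
    (hcod : ∀ x ∈ V, ∀ y ∈ V, G.Adj x y →
      (1 + l) ^ (#(V.filter fun z => G.Adj x z ∧ G.Adj y z) + 1) ≤ 2)
    (hdeg : ∀ v ∈ V, (#(V.filter (G.Adj v)) : ℝ) ≤ D)
    (hJ0 : 0 < J) (hJ : ∀ v ∈ V, ∀ I ∈ indepSets G V, (#(I.filter (G.Adj v)) : ℝ) ≤ J)
    (hM : 1 + T * l / 2 ≤ M) (hlog : J * M * Real.log (2 * #V) ≤ D)
    (hL : ∀ x ∈ V, T₀ ≤ #((range T).filter (L x))) :
    ∃ U ⊆ V, ∃ φ : α → ℕ,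
      (∀ x ∈ V, x ∉ U → φ x < T ∧ L x (φ x)) ∧
      (∀ x ∈ V, x ∉ U → ∀ y ∈ V, y ∉ U → G.Adj x y → φ x ≠ φ y) ∧
      ∀ v ∈ V, #(U.filter (G.Adj v)) * (τ * T₀ / D - 2) ≤ 4 * D := by
  have hM1 : 1 ≤ M := le_trans (le_add_of_nonneg_right (by positivity)) hM
  obtain ⟨U, hUV, φ, P, S, hφ, hprop, hP, hocc, hpot⟩ := exists_colouring_state (c := T) L hl hl1 hτ
    hD hcod hdeg hJ0 hJ hM hM1 le_rfl
  refine ⟨U, hUV, φ, hφ, hprop, ?_⟩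
  have hbound : ∀ v ∈ V, S v ≤ 4 * D ∧ ∑ x ∈ U with G.Adj v x, (1 + P x / 2) ≤ 2 * D := by
    intro v hv
    have hV : (0 : ℝ) < 2 * #V := by
      have := card_pos.2 ⟨v, hv⟩
      positivity
    have h1 := (single_le_sum (f := fun v =>
      Real.exp (J⁻¹ * (S v / 2 - #((V \ U).filter (G.Adj v))))
      + Real.exp ((J * M)⁻¹ * (∑ x ∈ U with G.Adj v x, (1 + P x / 2) - D)))
      (fun v _ => by positivity) hv).trans hpot
    have h2 : J⁻¹ * (S v / 2 - #((V \ U).filter (G.Adj v))) ≤ Real.log (2 * #V) := by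
      rw [Real.le_log_iff_exp_le hV]
      exact (le_add_of_nonneg_right (Real.exp_pos _).le).trans h1
    have h3 : (J * M)⁻¹ * (∑ x ∈ U with G.Adj v x, (1 + P x / 2) - D) ≤ Real.log (2 * #V) := by
      rw [Real.le_log_iff_exp_le hV]
      exact (le_add_of_nonneg_left (Real.exp_pos _).le).trans h1
    rw [inv_mul_le_iff₀ hJ0] at h2
    rw [inv_mul_le_iff₀ (by positivity)] at h3
    have h4 : (#((V \ U).filter (G.Adj v)) : ℝ) ≤ D :=
      le_trans (by exact_mod_cast card_le_card (filter_subset_filter _ sdiff_subset)) (hdeg v hv)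
    have h5 : 0 ≤ Real.log (2 * #V) := by
      refine Real.log_nonneg ?_
      have : (1 : ℝ) ≤ #V := by exact_mod_cast card_pos.2 ⟨v, hv⟩
      linarith
    have h6 : J * Real.log (2 * #V) ≤ J * M * Real.log (2 * #V) := by
      refine mul_le_mul_of_nonneg_right ?_ h5
      exact le_mul_of_one_le_right hJ0.le hM1
    exact ⟨by linarith, by linarith⟩
  intro v hv
  have h1 : ∀ x ∈ U.filter (G.Adj v), (τ * T₀ / D - 2) / 2 ≤ 1 + P x / 2 := by
    intro x hx
    have hxU := (mem_filter.1 hx).1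
    have h2 := hocc x hxU
    have h3 := (hbound x (hUV hxU)).1
    have h4 := mul_le_mul_of_nonneg_left (hL x (hUV hxU)) hτ
    have h5 : τ * T₀ / D ≤ P x + 4 := by
      rw [div_le_iff₀ hD0]
      linarith
    linarith
  have h2 := card_nsmul_le_sum _ _ _ h1
  rw [nsmul_eq_mul] at h2
  linarith [(hbound v hv).2]

end IterativeColouring

section Extension

variable {α : Type*} [DecidableEq α] {G : SimpleGraph α}

lemma exists_greedy_list_colouring (U : Finset α) (A : α → Finset ℕ)
    (h : ∀ x ∈ U, #(U.filter (G.Adj x)) < #(A x)) :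
    ∃ φ : α → ℕ, (∀ x ∈ U, φ x ∈ A x) ∧ ∀ x ∈ U, ∀ y ∈ U, G.Adj x y → φ x ≠ φ y := by
  induction U using Finset.induction_on with
  | empty => exact ⟨fun _ => 0, by simp, by simp⟩
  | insert a U ha ih =>
    obtain ⟨φ, hφ, hprop⟩ := ih fun x hx =>
      (card_le_card (filter_subset_filter _ (subset_insert a U))).trans_lt
        (h x (mem_insert_of_mem hx))
    obtain ⟨c, hc, hc'⟩ := exists_mem_notMem_of_card_lt_card
      ((card_image_le (f := φ)).trans_lt (h a (mem_insert_self a U)))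
    have hcφ : ∀ y ∈ U, G.Adj a y → φ y ≠ c := fun y hy hay hyc =>
      hc' (mem_image.2 ⟨y, mem_filter.2 ⟨mem_insert_of_mem hy, hay⟩, hyc⟩)
    have hne : ∀ y ∈ U, y ≠ a := fun y hy h => ha (h ▸ hy)
    refine ⟨Function.update φ a c, ?_, ?_⟩
    · intro x hx
      rcases mem_insert.1 hx with rfl | hx
      · simpa using hc
      · rw [Function.update_of_ne (hne x hx)]
        exact hφ x hx
    · intro x hx y hy hxy
      rcases mem_insert.1 hx with hxa | hxU <;> rcases mem_insert.1 hy with hya | hyU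
      · exact absurd (hxa.trans hya.symm) hxy.ne
      · rw [hxa, Function.update_self, Function.update_of_ne (hne y hyU)]
        exact (hcφ y hyU (hxa ▸ hxy)).symm
      · rw [hya, Function.update_self, Function.update_of_ne (hne x hxU)]
        exact hcφ x hxU (hya ▸ hxy).symm
      · rw [Function.update_of_ne (hne x hxU), Function.update_of_ne (hne y hyU)]
        exact hprop x hxU y hyU hxy

lemma card_sub_le_card_filter_forall_ne {β : Type*} (B : Finset β) (φ : β → ℕ) (Q : β → Prop)
    (s : Finset ℕ) :
    (#s : ℝ) - #(B.filter Q) ≤ #(s.filter fun c => ∀ y ∈ B, Q y → φ y ≠ c) := by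
  have h1 : s \ (B.filter Q).image φ ⊆ s.filter fun c => ∀ y ∈ B, Q y → φ y ≠ c := by
    intro c hc
    rw [mem_sdiff] at hc
    exact mem_filter.2 ⟨hc.1, fun y hy hQ hyc =>
      hc.2 (mem_image.2 ⟨y, mem_filter.2 ⟨hy, hQ⟩, hyc⟩)⟩
  have h2 := card_le_card h1
  have h3 := le_card_sdiff ((B.filter Q).image φ) s
  have h4 := card_image_le (s := B.filter Q) (f := φ)
  have h5 : #s ≤ #(s.filter fun c => ∀ y ∈ B, Q y → φ y ≠ c) + #(B.filter Q) := by omega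
  have : (#s : ℝ) ≤ #(s.filter fun c => ∀ y ∈ B, Q y → φ y ≠ c) + #(B.filter Q) := by
    exact_mod_cast h5
  linarith

/-- A proper colouring of `B` extends to a locally sparse set `V` of vertices that have few
neighbours in `B`. -/
lemma exists_colouring_extension {V B : Finset α} {l τ D J M T₀ : ℝ} {q : ℕ} (φ₀ : α → ℕ)
    (hl : 0 < l) (hl1 : l ≤ 1) (hτ : 0 ≤ τ) (hD : 2 * τ * Real.exp (4 * τ) ≤ l * D) (hD0 : 0 < D)
    (hcod : ∀ x ∈ V, ∀ y ∈ V, G.Adj x y →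
      (1 + l) ^ (#(V.filter fun z => G.Adj x z ∧ G.Adj y z) + 1) ≤ 2)
    (hdeg : ∀ v ∈ V, (#(V.filter (G.Adj v)) : ℝ) ≤ D)
    (hJ0 : 0 < J) (hJ : ∀ v ∈ V, ∀ I ∈ indepSets G V, (#(I.filter (G.Adj v)) : ℝ) ≤ J)
    (hM : 1 + q * l / 2 ≤ M) (hlog : J * M * Real.log (2 * #V) ≤ D)
    (hB : ∀ x ∈ V, T₀ ≤ q - #(B.filter (G.Adj x))) (hτT : 0 < τ * T₀ / D - 2)
    (hT : 4 * D < T₀ * (τ * T₀ / D - 2)) (hVB : Disjoint V B)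
    (hφ₀ : ∀ x ∈ B, φ₀ x < 2 * q) (hprop₀ : ∀ x ∈ B, ∀ y ∈ B, G.Adj x y → φ₀ x ≠ φ₀ y) :
    ∃ φ : α → ℕ, (∀ x ∈ V ∪ B, φ x < 2 * q) ∧
      ∀ x ∈ V ∪ B, ∀ y ∈ V ∪ B, G.Adj x y → φ x ≠ φ y := by
  set L : α → ℕ → Prop := fun x c => ∀ y ∈ B, G.Adj x y → φ₀ y ≠ c with hLdef
  obtain ⟨U, hUV, φ₁, hφ₁, hprop₁, hU⟩ := exists_partial_colouring (V := V) (T := q) (T₀ := T₀) L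
    hl hl1 hτ hD hD0 hcod hdeg hJ0 hJ hM hlog fun x hx => by
      have := card_sub_le_card_filter_forall_ne B φ₀ (G.Adj x) (range q)
      rw [card_range] at this
      refine (hB x hx).trans (this.trans_eq ?_)
      congr!
  obtain ⟨φ₂, hφ₂, hprop₂⟩ := exists_greedy_list_colouring (G := G) U
    (fun x => (Ico q (2 * q)).filter (L x)) fun x hx => by
      have h1 := card_sub_le_card_filter_forall_ne B φ₀ (G.Adj x) (Ico q (2 * q))
      have h2 : #(Ico q (2 * q)) = q := by rw [Nat.card_Ico]; omega
      rw [h2] at h1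
      have h3 := (hU x (hUV hx)).trans_lt hT
      have h4 := lt_of_mul_lt_mul_right h3 hτT.le
      have h5 := (h4.trans_le (hB x (hUV hx))).trans_le h1
      rw [Nat.cast_lt] at h5
      convert h5
  have hφ₂' : ∀ x ∈ U, q ≤ φ₂ x ∧ φ₂ x < 2 * q ∧ L x (φ₂ x) := fun x hx => by
    have := mem_filter.1 (hφ₂ x hx)
    exact ⟨(mem_Ico.1 this.1).1, (mem_Ico.1 this.1).2, this.2⟩
  set ψ : α → ℕ := fun x => if x ∈ U then φ₂ x else φ₁ x with hψ
  have hψV : ∀ x ∈ V, ψ x < 2 * q ∧ L x (ψ x) := by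
    intro x hx
    by_cases hxU : x ∈ U
    · simp only [hψ, hxU, if_true]
      exact (hφ₂' x hxU).2
    · simp only [hψ, hxU, if_false]
      have := hφ₁ x hx hxU
      exact ⟨by omega, this.2⟩
  have hψprop : ∀ x ∈ V, ∀ y ∈ V, G.Adj x y → ψ x ≠ ψ y := by
    intro x hx y hy hxy
    by_cases hxU : x ∈ U <;> by_cases hyU : y ∈ U <;> simp only [hψ, hxU, hyU, if_true, if_false]
    · exact hprop₂ x hxU y hyU hxy
    · exact ((hφ₁ y hy hyU).1.trans_le (hφ₂' x hxU).1).ne'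
    · exact ((hφ₁ x hx hxU).1.trans_le (hφ₂' y hyU).1).ne
    · exact hprop₁ x hx hxU y hy hyU hxy
  have hBV : ∀ x ∈ B, x ∉ V := fun x hx hxV => disjoint_left.1 hVB hxV hx
  refine ⟨fun x => if x ∈ V then ψ x else φ₀ x, ?_, ?_⟩
  · intro x hx
    by_cases hxV : x ∈ V
    · simpa only [hxV, if_true] using (hψV x hxV).1
    · simpa only [hxV, if_false] using hφ₀ x ((mem_union.1 hx).resolve_left hxV)
  · intro x hx y hy hxy
    by_cases hxV : x ∈ V <;> by_cases hyV : y ∈ V <;> simp only [hxV, hyV, if_true, if_false]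
    · exact hψprop x hxV y hyV hxy
    · exact ((hψV x hxV).2 y ((mem_union.1 hy).resolve_left hyV) hxy).symm
    · exact (hψV y hyV).2 x ((mem_union.1 hx).resolve_left hxV) hxy.symm
    · exact hprop₀ x ((mem_union.1 hx).resolve_left hxV) y ((mem_union.1 hy).resolve_left hyV) hxy

end Extension

section Hypergraph

variable {n : ℕ}

/-- The line graph on finite subsets of `Fin n`. -/
def meetGraph (n : ℕ) : SimpleGraph (Finset (Fin n)) where
  Adj e f := e ≠ f ∧ (e ∩ f).Nonempty
  symm := ⟨fun e f h => ⟨h.1.symm, by rw [inter_comm]; exact h.2⟩⟩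
  loopless := ⟨fun _ h => h.1 rfl⟩

lemma meetGraph_adj {e f : Finset (Fin n)} :
    (meetGraph n).Adj e f ↔ e ≠ f ∧ (e ∩ f).Nonempty := Iff.rfl

variable {H F : Finset (Finset (Fin n))}

lemma LinearHG.mono (hH : LinearHG H) (hF : F ⊆ H) : LinearHG F :=
  fun e he f hf => hH e (hF he) f (hF hf)

lemma LinearHG.eq_of_mem (hH : LinearHG H) {e f : Finset (Fin n)} (he : e ∈ H) (hf : f ∈ H)
    {v w : Fin n} (hvw : v ≠ w) (hve : v ∈ e) (hwe : w ∈ e) (hvf : v ∈ f) (hwf : w ∈ f) :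
    e = f := by
  by_contra hne
  exact hvw (card_le_one.1 (hH e he f hf hne) v (mem_inter.2 ⟨hve, hvf⟩) w
    (mem_inter.2 ⟨hwe, hwf⟩))

lemma LinearHG.degHG_le (hH : LinearHG H) {b : ℕ} (hb : 0 < b) (hsize : ∀ e ∈ H, b + 1 ≤ #e)
    (v : Fin n) : (degHG H v : ℝ) ≤ n / b := by
  have h1 : #((H.filter fun e => v ∈ e).biUnion fun e => e.erase v)
      = ∑ e ∈ H with v ∈ e, #(e.erase v) := by
    refine card_biUnion fun e he f hf hef => ?_
    replace he := mem_filter.1 (mem_coe.1 he)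
    replace hf := mem_filter.1 (mem_coe.1 hf)
    rw [Function.onFun, disjoint_left]
    intro w hwe hwf
    rw [mem_erase] at hwe hwf
    exact hef (hH.eq_of_mem he.1 hf.1 hwe.1 hwe.2 he.2 hwf.2 hf.2)
  have h2 : degHG H v * b ≤ n := by
    calc degHG H v * b = ∑ e ∈ H with v ∈ e, b := by rw [sum_const, smul_eq_mul, degHG]
      _ ≤ ∑ e ∈ H with v ∈ e, #(e.erase v) := by
          refine sum_le_sum fun e he => ?_
          rw [mem_filter] at he
          rw [card_erase_of_mem he.2]
          have := hsize e he.1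
          omega
      _ ≤ n := by
          rw [← h1]
          simpa using card_le_univ ((H.filter fun e => v ∈ e).biUnion fun e => e.erase v)
  rw [le_div_iff₀ (by exact_mod_cast hb)]
  exact_mod_cast h2

lemma card_filter_adj_le {d : ℝ} (hd : ∀ v, (degHG H v : ℝ) ≤ d) (e : Finset (Fin n)) :
    (#(H.filter ((meetGraph n).Adj e)) : ℝ) ≤ #e * d := by
  have h1 : H.filter ((meetGraph n).Adj e) ⊆ e.biUnion fun v => H.filter fun f => v ∈ f := by
    intro f hf
    rw [mem_filter, meetGraph_adj] at hf
    obtain ⟨v, hv⟩ := hf.2.2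
    rw [mem_inter] at hv
    exact mem_biUnion.2 ⟨v, hv.1, mem_filter.2 ⟨hf.1, hv.2⟩⟩
  calc (#(H.filter ((meetGraph n).Adj e)) : ℝ) ≤ ∑ v ∈ e, (degHG H v : ℝ) := by
        exact_mod_cast (card_le_card h1).trans card_biUnion_le
    _ ≤ ∑ v ∈ e, d := sum_le_sum fun v _ => hd v
    _ = #e * d := by rw [sum_const, nsmul_eq_mul]

lemma LinearHG.card_biUnion_pairs_le (hH : LinearHG H) (s : Finset (Fin n × Fin n))
    (hs : ∀ p ∈ s, p.1 ≠ p.2) :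
    #(s.biUnion fun p => H.filter fun f => p.1 ∈ f ∧ p.2 ∈ f) ≤ #s := by
  refine card_biUnion_le.trans ?_
  rw [card_eq_sum_ones]
  refine sum_le_sum fun p hp => card_le_one.2 fun f hf g hg => ?_
  rw [mem_filter] at hf hg
  exact hH.eq_of_mem hf.1 hg.1 (hs p hp) hf.2.1 hf.2.2 hg.2.1 hg.2.2

lemma LinearHG.card_common_neighbours_le (hH : LinearHG H) {d : ℝ}
    (hd : ∀ v, (degHG H v : ℝ) ≤ d) {e f : Finset (Fin n)} (he : e ∈ H) (hf : f ∈ H)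
    (hef : (meetGraph n).Adj e f) :
    (#(H.filter fun g => (meetGraph n).Adj e g ∧ (meetGraph n).Adj f g) : ℝ) ≤ d + #e * #f := by
  obtain ⟨w, hw⟩ := hef.2
  rw [mem_inter] at hw
  have h1 : H.filter (fun g => (meetGraph n).Adj e g ∧ (meetGraph n).Adj f g)
      ⊆ (H.filter fun g => w ∈ g) ∪ ((e ×ˢ f).filter fun p => p.1 ≠ p.2).biUnion
        fun p => H.filter fun g => p.1 ∈ g ∧ p.2 ∈ g := by
    intro g hg
    simp only [mem_filter, meetGraph_adj] at hg
    obtain ⟨hgH, ⟨-, v, hv⟩, -, x, hx⟩ := hg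
    rw [mem_inter] at hv hx
    rw [mem_union]
    by_cases hvx : v = x
    · left
      have hwv : w = v := by
        by_contra hwv
        exact hef.1 (hH.eq_of_mem he hf hwv hw.1 hv.1 hw.2 (hvx ▸ hx.1))
      exact mem_filter.2 ⟨hgH, hwv ▸ hv.2⟩
    · right
      exact mem_biUnion.2 ⟨(v, x), mem_filter.2 ⟨mem_product.2 ⟨hv.1, hx.1⟩, hvx⟩,
        mem_filter.2 ⟨hgH, hv.2, hx.2⟩⟩
  have h2 := hH.card_biUnion_pairs_le ((e ×ˢ f).filter fun p => p.1 ≠ p.2)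
    fun p hp => (mem_filter.1 hp).2
  have h3 : #((e ×ˢ f).filter fun p => p.1 ≠ p.2) ≤ #e * #f :=
    (card_filter_le _ _).trans (card_product _ _).le
  have h4 := (card_le_card h1).trans (card_union_le _ _)
  have h5 : #(H.filter fun g => (meetGraph n).Adj e g ∧ (meetGraph n).Adj f g)
      ≤ degHG H w + #e * #f := by
    rw [degHG]
    omega
  calc _ ≤ ((degHG H w + #e * #f : ℕ) : ℝ) := by exact_mod_cast h5
    _ ≤ d + #e * #f := by
      push_cast
      linarith [hd w]

lemma LinearHG.card_le_sq (hH : LinearHG H) (hsize : ∀ e ∈ H, 2 ≤ #e) : #H ≤ n ^ 2 := by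
  have h1 : H ⊆ ((univ : Finset (Fin n × Fin n)).filter fun p => p.1 ≠ p.2).biUnion
      fun p => H.filter fun g => p.1 ∈ g ∧ p.2 ∈ g := by
    intro g hg
    obtain ⟨v, hv, w, hw, hvw⟩ := one_lt_card.1 (hsize g hg)
    exact mem_biUnion.2 ⟨(v, w), mem_filter.2 ⟨mem_univ _, hvw⟩, mem_filter.2 ⟨hg, hv, hw⟩⟩
  refine (card_le_card h1).trans ((hH.card_biUnion_pairs_le _ fun p hp => (mem_filter.1 hp).2).trans
    ((card_filter_le _ _).trans ?_))
  simp [sq]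

lemma card_filter_adj_le_of_indep {I : Finset (Finset (Fin n))}
    (hI : I ∈ indepSets (meetGraph n) H) (e : Finset (Fin n)) :
    #(I.filter ((meetGraph n).Adj e)) ≤ #e := by
  have h1 : I.filter ((meetGraph n).Adj e) ⊆ e.biUnion fun v => I.filter fun f => v ∈ f := by
    intro f hf
    rw [mem_filter, meetGraph_adj] at hf
    obtain ⟨v, hv⟩ := hf.2.2
    rw [mem_inter] at hv
    exact mem_biUnion.2 ⟨v, hv.1, mem_filter.2 ⟨hf.1, hv.2⟩⟩
  refine (card_le_card h1).trans (card_biUnion_le.trans ?_)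
  rw [card_eq_sum_ones]
  refine sum_le_sum fun v _ => card_le_one.2 fun f hf g hg => ?_
  rw [mem_filter] at hf hg
  by_contra hfg
  exact (mem_indepSets.1 hI).2 f hf.1 g hg.1 ⟨hfg, v, mem_inter.2 ⟨hf.2, hg.2⟩⟩

lemma LinearHG.card_mul_le (hH : LinearHG H) {b : ℕ} (hb : 0 < b) (hsize : ∀ e ∈ H, b + 1 ≤ #e) :
    (#H : ℝ) * b ^ 2 ≤ n ^ 2 := by
  have h1 : ∑ v : Fin n, degHG H v = ∑ e ∈ H, #e := by
    have := sum_card_bipartiteAbove_eq_sum_card_bipartiteBelow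
      (s := (univ : Finset (Fin n))) (t := H) (fun v e => v ∈ e)
    simpa [bipartiteAbove, bipartiteBelow, degHG] using this
  have hb' : (0 : ℝ) < b := by exact_mod_cast hb
  have h2 : (#H : ℝ) * b ≤ n * (n / b) := by
    calc (#H : ℝ) * b = ∑ e ∈ H, (b : ℝ) := by rw [sum_const, nsmul_eq_mul]
      _ ≤ ∑ e ∈ H, (#e : ℝ) := by
          refine sum_le_sum fun e he => ?_
          exact_mod_cast (Nat.le_succ b).trans (hsize e he)
      _ = ∑ v : Fin n, (degHG H v : ℝ) := by exact_mod_cast h1.symm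
      _ ≤ ∑ v : Fin n, (n / b : ℝ) := sum_le_sum fun v _ => hH.degHG_le hb hsize v
      _ = _ := by simp
  rw [← mul_div_assoc, le_div_iff₀ hb'] at h2
  nlinarith

lemma isProperEC_iff {φ : Finset (Fin n) → ℕ} :
    IsProperEC H φ ↔ ∀ e ∈ H, ∀ f ∈ H, (meetGraph n).Adj e f → φ e ≠ φ f := by
  simp only [IsProperEC, meetGraph_adj, and_imp]

lemma ChromIndexLE.union {H₁ H₂ : Finset (Finset (Fin n))} {k₁ k₂ : ℕ}
    (h₁ : ChromIndexLE H₁ k₁) (h₂ : ChromIndexLE H₂ k₂) :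
    ChromIndexLE (H₁ ∪ H₂) (k₁ + k₂) := by
  obtain ⟨φ₁, hφ₁, hp₁⟩ := h₁
  obtain ⟨φ₂, hφ₂, hp₂⟩ := h₂
  refine ⟨fun e => if e ∈ H₁ then φ₁ e else k₁ + φ₂ e, fun e he => ?_, fun e he f hf hne hef => ?_⟩
  · by_cases h : e ∈ H₁
    · simp only [h, if_true]
      exact (hφ₁ e h).trans_le (Nat.le_add_right _ _)
    · simp only [h, if_false]
      exact Nat.add_lt_add_left (hφ₂ e ((mem_union.1 he).resolve_left h)) _
  · by_cases h : e ∈ H₁ <;> by_cases h' : f ∈ H₁ <;> simp only [h, h', if_true, if_false]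
    · exact hp₁ e h f h' hne hef
    · exact ((hφ₁ e h).trans_le (Nat.le_add_right _ _)).ne
    · exact ((hφ₁ f h').trans_le (Nat.le_add_right _ _)).ne'
    · have := hp₂ e ((mem_union.1 he).resolve_left h) f ((mem_union.1 hf).resolve_left h') hne hef
      omega

lemma chromIndexLE_of_card_filter_adj_lt {k : ℕ}
    (h : ∀ e ∈ H, #(H.filter ((meetGraph n).Adj e)) < k) : ChromIndexLE H k := by
  obtain ⟨φ, hφ, hp⟩ := exists_greedy_list_colouring (G := meetGraph n) H (fun _ => range k)
    (by simpa using h)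
  exact ⟨φ, fun e he => mem_range.1 (hφ e he), isProperEC_iff.2 hp⟩

lemma div_pred_le {x : ℝ} (hx : 0 ≤ x) {a : ℕ} (ha : 2 ≤ a) : x / (a - 1 : ℕ) ≤ 2 * x / a := by
  have h1 : (2 : ℝ) ≤ a := by exact_mod_cast ha
  rw [Nat.cast_sub (by omega), Nat.cast_one, div_le_div_iff₀ (by linarith) (by linarith)]
  nlinarith

lemma one_add_pow_le_two {l : ℝ} (hl : 0 ≤ l) {k : ℕ} (h : l * k ≤ 1 / 2) : (1 + l) ^ k ≤ 2 := by
  have h1 : (1 + l) ^ k ≤ Real.exp (1 / 2) := by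
    calc (1 + l) ^ k ≤ (Real.exp l) ^ k := by
          gcongr; rw [add_comm]; exact Real.add_one_le_exp l
      _ = Real.exp (l * k) := by rw [← Real.exp_nat_mul, mul_comm]
      _ ≤ _ := Real.exp_le_exp.2 h
  have h2 := Real.add_one_le_exp (-(1 / 2 : ℝ))
  rw [Real.exp_neg] at h2
  have h3 : (0 : ℝ) < Real.exp (1 / 2) := Real.exp_pos _
  have h4 : Real.exp (1 / 2) * (Real.exp (1 / 2))⁻¹ = 1 := mul_inv_cancel₀ h3.ne'
  nlinarith

/-- The edges whose sizes lie in one of the intervals `[K ^ i, K ^ (i + 1))`, with `i` of a fixed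
parity, can be coloured with `2 * q` colours, where `q` is proportional to `n`. -/
lemma LinearHG.chromIndexLE_of_parity (hH : LinearHG H) {ε η τ B : ℝ} {K m q r : ℕ} (hε : 0 < ε)
    (hK : 2 ≤ K) (hKε : 80 / ε ≤ K) (hτ : τ = 80 * K / ε * (2 + 400 * K / ε))
    (hB : B = 2 * τ * Real.exp (4 * τ)) (hm1 : 1 ≤ m) (hm : 6 * B ≤ (K : ℝ) ^ m)
    (hη0 : 0 < η) (hη1 : η ≤ 1) (hη : 6 * B * η ^ 2 ≤ 1) (hn0 : 0 < n) (hn : 6 * B ≤ n)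
    (hlog : (1 + ε * B) * Real.log (2 * n ^ 2) ≤ Real.sqrt n)
    (hq : ε * n / 20 ≤ q) (hq' : q ≤ ε * n / 10)
    (hlow : ∀ e ∈ H, K ^ m ≤ #e) (hup : ∀ e ∈ H, (#e : ℝ) ≤ η * Real.sqrt n)
    (hpar : ∀ e ∈ H, Nat.log K #e % 2 = r) : ChromIndexLE H (2 * q) := by
  have hK0 : (0 : ℝ) < K := by positivity
  have hK2 : (2 : ℝ) ≤ K := by exact_mod_cast hK
  have hn0' : (0 : ℝ) < n := by exact_mod_cast hn0
  have hτ0 : 0 < τ := by rw [hτ]; positivity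
  have hB0 : 0 < B := by rw [hB]; positivity
  have hD0 : (0 : ℝ) < 2 * K * n := by positivity
  have hsq : 0 < Real.sqrt n := Real.sqrt_pos.2 hn0'
  have hsq2 : Real.sqrt n * Real.sqrt n = n := Real.mul_self_sqrt hn0'.le
  set l : ℝ := B / (2 * K * n) with hl
  have hl0 : 0 < l := by positivity
  have hlD : l * (2 * K * n) = B := div_mul_cancel₀ _ hD0.ne'
  have hl1 : l ≤ 1 := by
    rw [hl, div_le_one hD0]
    nlinarith
  have hne : ∀ e ∈ H, #e ≠ 0 := fun e he => by
    have := hlow e he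
    have : 0 < K ^ m := by positivity
    omega
  have hlev : ∀ e ∈ H, K ^ Nat.log K #e ≤ #e ∧ #e < K ^ (Nat.log K #e + 1) := fun e he =>
    ⟨Nat.pow_log_le_self K (hne e he), Nat.lt_pow_succ_log_self (by omega) _⟩
  have hKpow : ∀ i, m ≤ i → 2 ≤ K ^ i := fun i hi =>
    hK.trans (Nat.le_self_pow (by omega) K)
  have main : ∀ d : ℕ, ChromIndexLE (H.filter fun e => n < Nat.log K #e + d) (2 * q) := by
    intro d
    induction d with
    | zero =>
      refine ⟨fun _ => 0, fun e he => ?_, fun e he => ?_⟩ <;>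
      · exfalso
        have h1 := (mem_filter.1 he).2
        have h2 := Nat.log_le_self K #e
        have h3 : #e ≤ n := by simpa using card_le_univ e
        omega
    | succ d ih =>
      obtain ⟨φ₀, hφ₀, hp₀⟩ := ih
      rw [isProperEC_iff] at hp₀
      set V := H.filter fun e => Nat.log K #e + d = n with hV
      set C := H.filter fun e => n < Nat.log K #e + d with hC
      have hVH : V ⊆ H := filter_subset _ _
      have hCH : C ⊆ H := filter_subset _ _
      set i := n - d with hi
      have hVi : ∀ e ∈ V, m ≤ i ∧ K ^ i ≤ #e ∧ #e < K ^ (i + 1) := by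
        intro e he
        have h1 := mem_filter.1 he
        have h2 : Nat.log K #e = i := by omega
        have h3 := hlev e h1.1
        rw [h2] at h3
        refine ⟨?_, h3⟩
        rw [← h2]
        exact Nat.le_log_of_pow_le (by omega) (hlow e h1.1)
      have hCi : ∀ e ∈ V, ∀ f ∈ C, K ^ (i + 2) ≤ #f := by
        intro e he f hf
        have h1 := mem_filter.1 he
        have h2 := mem_filter.1 hf
        have h3 := hpar e h1.1
        have h4 := hpar f h2.1
        refine (Nat.pow_le_pow_right (by omega) ?_).trans (hlev f h2.1).1
        omega
      have hdegV : ∀ e ∈ V, ∀ v, (degHG V v : ℝ) ≤ 2 * n / (K : ℝ) ^ i := by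
        intro e he v
        have h2 := hKpow i (hVi e he).1
        have h1 := (hH.mono hVH).degHG_le (b := K ^ i - 1) (by omega)
          (fun f hf => by have := (hVi f hf).2.1; omega) v
        have h3 := div_pred_le hn0'.le h2
        push_cast at h3
        exact h1.trans h3
      have hdegC : ∀ e ∈ V, ∀ v, (degHG C v : ℝ) ≤ 2 * n / (K : ℝ) ^ (i + 2) := by
        intro e he v
        have h2 := hKpow (i + 2) ((hVi e he).1.trans (by omega))
        have h1 := (hH.mono hCH).degHG_le (b := K ^ (i + 2) - 1) (by omega)
          (fun f hf => by have := hCi e he f hf; omega) v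
        have h3 := div_pred_le hn0'.le h2
        push_cast at h3
        exact h1.trans h3
      have hcard : ∀ e ∈ V, (#e : ℝ) ≤ K * (K : ℝ) ^ i := by
        intro e he
        rw [mul_comm, ← pow_succ]
        exact_mod_cast (hVi e he).2.2.le
      have hKi : (0 : ℝ) < (K : ℝ) ^ i := by positivity
      have hunion : H.filter (fun e => n < Nat.log K #e + (d + 1)) = V ∪ C := by
        ext e
        simp only [hV, hC, mem_union, mem_filter, ← and_or_left]
        refine and_congr_right fun _ => ?_
        omega
      suffices h : ∃ φ : Finset (Fin n) → ℕ, (∀ e ∈ V ∪ C, φ e < 2 * q) ∧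
          ∀ e ∈ V ∪ C, ∀ f ∈ V ∪ C, (meetGraph n).Adj e f → φ e ≠ φ f by
        rw [hunion]
        obtain ⟨φ, hφ, hp⟩ := h
        exact ⟨φ, hφ, isProperEC_iff.2 hp⟩
      refine exists_colouring_extension (l := l) (τ := τ) (D := 2 * K * n) (J := Real.sqrt n)
        (M := 1 + ε * B) (T₀ := ε * n / 40) φ₀ hl0 hl1 hτ0.le (by rw [hlD, hB]) hD0 ?_ ?_ hsq ?_ ?_
        ?_ ?_ ?_ ?_ ?_ hφ₀ hp₀
      · intro e he f hf hef
        refine one_add_pow_le_two hl0.le ?_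
        have h1 := (hH.mono hVH).card_common_neighbours_le (hdegV e he) he hf hef
        have h2 : (#e : ℝ) * #f ≤ η ^ 2 * n := by
          calc (#e : ℝ) * #f ≤ (η * Real.sqrt n) * (η * Real.sqrt n) := by
                have := hup e (hVH he)
                have := hup f (hVH hf)
                gcongr
            _ = η ^ 2 * (Real.sqrt n * Real.sqrt n) := by ring
            _ = η ^ 2 * n := by rw [hsq2]
        have h3 : 2 * n / (K : ℝ) ^ i * (6 * B) ≤ 2 * n := by
          have : (K : ℝ) ^ m ≤ (K : ℝ) ^ i := pow_le_pow_right₀ (by linarith) (hVi e he).1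
          rw [div_mul_eq_mul_div, div_le_iff₀ hKi]
          have := hm.trans this
          gcongr
        push_cast
        rw [hl, div_mul_eq_mul_div, div_le_iff₀ hD0]
        have h4 := mul_le_mul_of_nonneg_left (add_le_add_left (h1.trans (add_le_add_right h2 _)) 1)
          hB0.le
        have h5 := mul_le_mul_of_nonneg_right hη hn0'.le
        have h6 := mul_le_mul_of_nonneg_right hK2 hn0'.le
        linarith
      · intro e he
        refine (card_filter_adj_le (hdegV e he) e).trans ?_
        calc (#e : ℝ) * (2 * n / (K : ℝ) ^ i) ≤ (K * (K : ℝ) ^ i) * (2 * n / (K : ℝ) ^ i) := by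
              have := hcard e he
              gcongr
          _ = 2 * K * n := by field_simp
      · intro e he I hI
        have h1 : (#(I.filter ((meetGraph n).Adj e)) : ℝ) ≤ #e := by
          exact_mod_cast card_filter_adj_le_of_indep hI e
        have := hup e (hVH he)
        nlinarith
      · have : (q : ℝ) * l / 2 ≤ ε * B := by
          rw [hl, ← mul_div_assoc, div_div, div_le_iff₀ (by positivity)]
          have h1 := mul_le_mul_of_nonneg_right hq' hB0.le
          have h2 := mul_le_mul_of_nonneg_right hK2 (by positivity : 0 ≤ ε * n * B)
          nlinarith [(by positivity : 0 ≤ ε * n * B)]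
        linarith
      · have h1 : Real.log (2 * #V) ≤ Real.log (2 * n ^ 2) := by
          rcases V.eq_empty_or_nonempty with h | h
          · rw [h]
            simp only [card_empty, Nat.cast_zero, mul_zero, Real.log_zero]
            refine Real.log_nonneg ?_
            have : (1 : ℝ) ≤ n := by exact_mod_cast hn0
            nlinarith
          · have h1 : 0 < #V := card_pos.2 h
            have h2 : #V ≤ n ^ 2 := (hH.mono hVH).card_le_sq fun e he =>
              (hKpow i (hVi e he).1).trans (hVi e he).2.1
            have h2' : (#V : ℝ) ≤ n ^ 2 := by exact_mod_cast h2
            exact Real.log_le_log (by positivity) (by linarith)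
        calc Real.sqrt n * (1 + ε * B) * Real.log (2 * #V)
            ≤ Real.sqrt n * (1 + ε * B) * Real.log (2 * n ^ 2) := by gcongr
          _ = Real.sqrt n * ((1 + ε * B) * Real.log (2 * n ^ 2)) := by ring
          _ ≤ Real.sqrt n * Real.sqrt n := by gcongr
          _ ≤ 2 * K * n := by rw [hsq2]; nlinarith
      · intro e he
        have h1 := card_filter_adj_le (hdegC e he) e
        have h2 : (#e : ℝ) * (2 * n / (K : ℝ) ^ (i + 2)) ≤ ε * n / 40 := by
          calc (#e : ℝ) * (2 * n / (K : ℝ) ^ (i + 2))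
              ≤ (K * (K : ℝ) ^ i) * (2 * n / (K : ℝ) ^ (i + 2)) := by
                have := hcard e he
                gcongr
            _ = 2 * n / K := by rw [pow_add]; field_simp
            _ ≤ ε * n / 40 := by
              rw [div_le_iff₀ hε] at hKε
              rw [div_le_div_iff₀ hK0 (by norm_num)]
              nlinarith
        linarith
      · have : τ * (ε * n / 40) / (2 * K * n) - 2 = 400 * K / ε := by
          rw [hτ]; field_simp; ring
        rw [this]
        positivity
      · have : τ * (ε * n / 40) / (2 * K * n) - 2 = 400 * K / ε := by
          rw [hτ]; field_simp; ring
        rw [this]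
        have h2 : ε * n / 40 * (400 * K / ε) = 10 * K * n := by field_simp; ring
        rw [h2]
        linarith
      · rw [disjoint_left]
        intro e he he'
        have := (mem_filter.1 he).2
        have := (mem_filter.1 he').2
        omega
  have h := main (n + 1)
  rwa [filter_true_of_mem fun e _ => by omega] at h

lemma LinearHG.chromIndexLE_of_large (hH : LinearHG H) {η : ℝ} {q : ℕ} (hη0 : 0 < η)
    (hη1 : η ≤ 1 / 2) (hn : (4 : ℝ) ≤ n) (hq : 4 * η ^ 2 * n < q)
    (hlow : ∀ e ∈ H, Real.sqrt n / η ≤ (#e : ℝ)) : ChromIndexLE H q := by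
  have hn' : (0 : ℝ) < n := by linarith
  have hsq2 : Real.sqrt n * Real.sqrt n = n := Real.mul_self_sqrt hn'.le
  set b := ⌈Real.sqrt n / η⌉₊ - 1 with hb
  have hs2 : 2 ≤ Real.sqrt n := by
    rw [Real.le_sqrt' (by norm_num)]
    linarith
  have hs4 : 4 ≤ Real.sqrt n / η := by
    rw [le_div_iff₀ hη0]
    linarith
  have hc : 4 ≤ ⌈Real.sqrt n / η⌉₊ := by
    exact_mod_cast hs4.trans (Nat.le_ceil _)
  have hbreal : Real.sqrt n / η / 2 ≤ b := by
    have h1 := Nat.le_ceil (Real.sqrt n / η)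
    rw [hb, Nat.cast_sub (by omega)]
    push_cast
    linarith
  have h1 := hH.card_mul_le (b := b) (by omega) fun f hf => by
    have := Nat.ceil_le.2 (hlow f hf)
    omega
  have h2 : (#H : ℝ) * (n / (4 * η ^ 2)) ≤ n ^ 2 := by
    refine le_trans (mul_le_mul_of_nonneg_left ?_ (Nat.cast_nonneg _)) h1
    have : (n : ℝ) / (4 * η ^ 2) = (Real.sqrt n / η / 2) ^ 2 := by
      rw [div_pow, div_pow, sq (Real.sqrt n), hsq2, div_div]
      ring
    rw [this]
    exact pow_le_pow_left₀ (by linarith) hbreal 2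
  have h3 : (#H : ℝ) ≤ 4 * η ^ 2 * n := by
    rw [← mul_div_assoc, div_le_iff₀ (by positivity)] at h2
    refine le_of_mul_le_mul_right (h2.trans_eq ?_) hn'
    ring
  refine chromIndexLE_of_card_filter_adj_lt fun e _ => (card_filter_le _ _).trans_lt ?_
  exact_mod_cast h3.trans_lt hq

end Hypergraph

lemma eventually_mul_log_le_sqrt {C : ℝ} (hC : 0 < C) :
    ∀ᶠ n : ℕ in Filter.atTop, C * Real.log (2 * n ^ 2) ≤ Real.sqrt n := by
  have h1 := (isLittleO_log_rpow_atTop (r := 1 / 2) (by norm_num)).bound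
    (c := 1 / (3 * C)) (by positivity)
  filter_upwards [tendsto_natCast_atTop_atTop.eventually h1, Filter.eventually_ge_atTop 2]
    with n hn hn2
  have hn2' : (2 : ℝ) ≤ n := by exact_mod_cast hn2
  rw [← Real.sqrt_eq_rpow, Real.norm_of_nonneg (Real.sqrt_nonneg _)] at hn
  have h2 := (le_abs_self _).trans hn
  have h3 : Real.log (2 * n ^ 2) ≤ 3 * Real.log n := by
    rw [Real.log_mul (by norm_num) (by positivity), Real.log_pow]
    have := Real.log_le_log (by norm_num) hn2'
    push_cast
    linarith
  calc C * Real.log (2 * n ^ 2) ≤ C * (3 * (1 / (3 * C) * Real.sqrt n)) := by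
        refine mul_le_mul_of_nonneg_left ?_ hC.le
        linarith
    _ = Real.sqrt n := by field_simp

/-- Sublinear stability: for every `ε > 0` there exist `n0` and `η > 0` such that every
`n`-vertex linear hypergraph (`n ≥ n0`) of maximum degree at most `ηn` with no edge of size
strictly between `η√n` and `√n/η` has chromatic index at most `εn`. -/
theorem sublinear_stability :
    ∀ ε : ℝ, 0 < ε →
      ∃ (n0 : ℕ) (η : ℝ), 0 < η ∧
        ∀ n : ℕ, n0 ≤ n → ∀ H : Finset (Finset (Fin n)),
          (∀ e ∈ H, e.Nonempty) → LinearHG H →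
          (∀ v : Fin n, (degHG H v : ℝ) ≤ η * n) →
          (∀ e ∈ H, ¬(η * Real.sqrt n < (e.card : ℝ) ∧ (e.card : ℝ) < Real.sqrt n / η)) →
          ∃ k : ℕ, (k : ℝ) ≤ ε * n ∧ ChromIndexLE H k := by
  intro ε hε
  obtain ⟨K, hKε⟩ := exists_nat_ge (max 2 (80 / ε))
  have hK2 : 2 ≤ K := by exact_mod_cast (le_max_left _ _).trans hKε
  have hK80 : 80 / ε ≤ K := (le_max_right _ _).trans hKε
  have hK0 : 0 < K := by omega
  obtain ⟨τ, hτ⟩ : ∃ τ : ℝ, τ = 80 * K / ε * (2 + 400 * K / ε) := ⟨_, rfl⟩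
  obtain ⟨B, hB⟩ : ∃ B : ℝ, B = 2 * τ * Real.exp (4 * τ) := ⟨_, rfl⟩
  have hτ0 : 0 < τ := by rw [hτ]; positivity
  have hB0 : 0 < B := by rw [hB]; positivity
  obtain ⟨m, hm⟩ := exists_nat_ge (max 1 (6 * B))
  have hm1 : 1 ≤ m := by exact_mod_cast (le_max_left _ _).trans hm
  have hmB : 6 * B ≤ (K : ℝ) ^ m := by
    refine ((le_max_right _ _).trans hm).trans ?_
    exact_mod_cast (Nat.lt_pow_self hK2).le
  have hKm : (0 : ℝ) < (K : ℝ) ^ m := by positivity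
  obtain ⟨η, hη0, hη1, hηε, hηK, hηB⟩ : ∃ η : ℝ, 0 < η ∧ η ≤ 1 / 2 ∧ 80 * η ≤ ε ∧
      40 * (K : ℝ) ^ m * η ≤ ε ∧ 6 * B * η ≤ 1 := by
    refine ⟨min (min (1 / 2) (ε / 80)) (min (ε / (40 * (K : ℝ) ^ m)) (1 / (6 * B))), ?_, ?_, ?_, ?_,
      ?_⟩
    · positivity
    · exact (min_le_left _ _).trans (min_le_left _ _)
    · rw [← le_div_iff₀' (by positivity)]
      exact (min_le_left _ _).trans (min_le_right _ _)
    · rw [← le_div_iff₀' (by positivity)]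
      exact (min_le_right _ _).trans (min_le_left _ _)
    · rw [← le_div_iff₀' (by positivity)]
      exact (min_le_right _ _).trans (min_le_right _ _)
  obtain ⟨n₁, hn₁⟩ := Filter.eventually_atTop.1
    (eventually_mul_log_le_sqrt (by positivity : 0 < 1 + ε * B))
  obtain ⟨n₂, hn₂⟩ := exists_nat_ge (max (6 * B) (max (20 / ε) 4))
  refine ⟨max n₁ n₂, η, hη0, ?_⟩
  intro n hn H hHne hH hdeg hsize
  have hnn : (n₂ : ℝ) ≤ n := by exact_mod_cast (le_max_right _ _).trans hn
  have hnB : 6 * B ≤ n := ((le_max_left _ _).trans hn₂).trans hnn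
  have hnε : 20 / ε ≤ n :=
    (((le_max_left _ _).trans (le_max_right _ _)).trans hn₂).trans hnn
  have hn4 : (4 : ℝ) ≤ n := (((le_max_right _ _).trans (le_max_right _ _)).trans hn₂).trans hnn
  have hlog := hn₁ n ((le_max_left _ _).trans hn)
  rw [div_le_iff₀ hε] at hnε
  have hn0 : 0 < n := by
    have : (0 : ℝ) < n := by linarith
    exact_mod_cast this
  set q := ⌊ε * n / 10⌋₊ with hqdef
  have hq' : (q : ℝ) ≤ ε * n / 10 := Nat.floor_le (by positivity)
  have hq : ε * n / 20 ≤ q := by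
    have := Nat.lt_floor_add_one (ε * n / 10)
    linarith
  set H₁ := H.filter fun e => #e < K ^ m with hH₁
  set H₂ := H.filter fun e => K ^ m ≤ #e ∧ (#e : ℝ) ≤ η * Real.sqrt n with hH₂
  set H₃ := H.filter fun e => Real.sqrt n / η ≤ (#e : ℝ) with hH₃
  have hcover : H = H₁ ∪ (H₂.filter (fun e => Nat.log K #e % 2 = 0)
      ∪ H₂.filter (fun e => Nat.log K #e % 2 = 1)) ∪ H₃ := by
    ext e
    simp only [hH₁, hH₂, hH₃, mem_union, mem_filter]
    constructor
    · intro he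
      have h1 := hsize e he
      rw [not_and_or, not_lt, not_lt] at h1
      have h2 := Nat.mod_two_eq_zero_or_one (Nat.log K #e)
      have h3 := lt_or_ge #e (K ^ m)
      tauto
    · tauto
  have hsmall : ChromIndexLE H₁ q := by
    refine chromIndexLE_of_card_filter_adj_lt fun e he => ?_
    have h1 := card_filter_adj_le hdeg e
    have h2 : (#e : ℝ) < (K : ℝ) ^ m := by exact_mod_cast (mem_filter.1 he).2
    have h3 : (#(H₁.filter ((meetGraph n).Adj e)) : ℝ) ≤ #(H.filter ((meetGraph n).Adj e)) := by
      exact_mod_cast card_le_card (filter_subset_filter _ (filter_subset _ _))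
    have h4 : (#e : ℝ) * (η * n) ≤ (K : ℝ) ^ m * (η * n) := by gcongr
    have h5 := mul_le_mul_of_nonneg_right hηK (Nat.cast_nonneg (α := ℝ) n)
    have h6 : (0 : ℝ) < ε * n := by positivity
    have : (#(H₁.filter ((meetGraph n).Adj e)) : ℝ) < q := by linarith
    exact_mod_cast this
  have hmedium : ∀ r, ChromIndexLE (H₂.filter fun e => Nat.log K #e % 2 = r) (2 * q) := by
    intro r
    have hsub : H₂.filter (fun e => Nat.log K #e % 2 = r) ⊆ H :=
      (filter_subset _ _).trans (filter_subset _ _)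
    refine (hH.mono hsub).chromIndexLE_of_parity hε hK2 hK80 hτ hB hm1 hmB hη0 (by linarith)
      (by nlinarith) hn0 hnB hlog hq hq' ?_ ?_ fun e he => (mem_filter.1 he).2
    · exact fun e he => (mem_filter.1 (mem_filter.1 he).1).2.1
    · exact fun e he => (mem_filter.1 (mem_filter.1 he).1).2.2
  have hlarge : ChromIndexLE H₃ q := by
    refine (hH.mono (filter_subset _ _)).chromIndexLE_of_large hη0 hη1 hn4 ?_
      fun e he => (mem_filter.1 he).2
    have h1 := mul_le_mul_of_nonneg_right hηε (Nat.cast_nonneg (α := ℝ) n)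
    have h2 : 0 < ε * n := by positivity
    have h3 : 4 * η ^ 2 * n ≤ 2 * (η * n) := by
      nlinarith [mul_nonneg hη0.le (Nat.cast_nonneg (α := ℝ) n)]
    linarith
  refine ⟨q + (2 * q + 2 * q) + q, ?_, ?_⟩
  · push_cast
    have : 0 ≤ ε * n := by positivity
    linarith
  · rw [hcover]
    exact (hsmall.union ((hmedium 0).union (hmedium 1))).union hlarge
end

section
/- There exists δ0 ∈ (0,1) such that for every δ ∈ (0, δ0] there exists n0 ∈ ℕ with the following property: for every n ≥ n0, if H is an n-vertex linear hypergraph in which every edge e satisfies |e| ≥ (1−δ)√n, then H has a proper edge-colouring with n colours in which each colour is assigned to at most two edges. -/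
open Finset
open scoped Classical

/-- Each colour is assigned to at most two edges of `H` by `φ`. -/
def ColoursUsedAtMostTwice {n : ℕ} (H : Finset (Finset (Fin n)))
    (φ : Finset (Fin n) → ℕ) : Prop :=
  ∀ c : ℕ, (H.filter fun e => φ e = c).card ≤ 2

section Matching

variable {V : Type*} [Fintype V] [DecidableEq V]

/-- A maximum matching, encoded as an involution whose fixed points are the unmatched vertices:
no two unmatched vertices are adjacent, and no augmenting path of length three exists. -/
lemma exists_involution_without_short_augmenting_path (G : SimpleGraph V) :
    ∃ σ : V → V, (∀ x, σ (σ x) = x) ∧ (∀ x, σ x ≠ x → G.Adj x (σ x)) ∧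
      (∀ u v, σ u = u → σ v = v → ¬ G.Adj u v) ∧
      (∀ a u v, σ a ≠ a → σ u = u → σ v = v → G.Adj a u → G.Adj (σ a) v → u = v) := by
  have hne : ((univ : Finset (V → V)).filter fun σ =>
      (∀ x, σ (σ x) = x) ∧ (∀ x, σ x ≠ x → G.Adj x (σ x))).Nonempty :=
    ⟨id, by simp⟩
  obtain ⟨σ, hσ, hmin⟩ := exists_min_image _
    (fun σ : V → V => (univ.filter fun x => σ x = x).card) hne
  simp only [mem_filter, mem_univ, true_and] at hσ hmin
  obtain ⟨hinv, hadj⟩ := hσ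
  have no_better : ∀ (τ : V → V) (u : V), (∀ x, τ (τ x) = x) → (∀ x, τ x ≠ x → G.Adj x (τ x)) →
      (∀ x, τ x = x → σ x = x) → σ u = u → τ u ≠ u → False := by
    intro τ u h1 h2 h3 hu hτu
    have hlt : (univ.filter fun x => τ x = x).card < (univ.filter fun x => σ x = x).card := by
      apply card_lt_card
      rw [Finset.ssubset_iff_of_subset]
      · exact ⟨u, by simpa using hu, by simpa using hτu⟩
      · intro x hx
        simp only [mem_filter, mem_univ, true_and] at hx ⊢
        exact h3 x hx
    exact absurd (hmin τ ⟨h1, h2⟩) (not_le.mpr hlt)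
  refine ⟨σ, hinv, hadj, ?_, ?_⟩
  · intro u v hu hv huv
    have huv' := huv.symm
    have hne := huv.ne
    refine no_better (fun x => if x = u then v else if x = v then u else σ x) u ?_ ?_ ?_ hu ?_
    · intro x
      have := hinv x
      grind
    · intro x hx
      have := hadj x
      grind
    · intro x hx
      grind
    · grind
  · intro a u v ha hu hv hau hbv
    by_contra hne
    have hua := hau.symm
    have hvb := hbv.symm
    refine no_better (fun x => if x = u then a else if x = a then u else if x = σ a then v
      else if x = v then σ a else σ x) u ?_ ?_ ?_ hu ?_
    · intro x
      have := hinv x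
      grind
    · intro x hx
      have := hadj x
      grind
    · intro x hx
      grind
    · grind

/-- The orbits of an involution can be numbered with `(|V| + |Fix σ|) / 2` colours. -/
lemma exists_colouring_of_involution (σ : V → V) (hinv : ∀ x, σ (σ x) = x) (n : ℕ)
    (hn : Fintype.card V + (univ.filter fun x => σ x = x).card ≤ 2 * n) :
    ∃ φ : V → ℕ, (∀ x, φ x < n) ∧ ∀ x y, φ x = φ y → y = x ∨ y = σ x := by
  let T : Finset (Finset V) := univ.image fun x => {x, σ x}
  let ι : V → ℕ := fun x => (Fintype.equivFin V x : ℕ)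
  have hι : ∀ x y, ι x = ι y → x = y := fun x y h =>
    (Fintype.equivFin V).injective (Fin.ext h)
  have hcard : T.card ≤ n := by
    have hT : T ⊆ (univ.filter fun x => ι x ≤ ι (σ x)).image fun x => {x, σ x} := by
      intro s hs
      obtain ⟨x, -, rfl⟩ := mem_image.mp hs
      rcases le_total (ι x) (ι (σ x)) with h | h
      · exact mem_image.mpr ⟨x, by simpa using h, rfl⟩
      · exact mem_image.mpr ⟨σ x, by simpa [hinv] using h, by rw [hinv, pair_comm]⟩
    have h1 := (card_le_card hT).trans card_image_le
    have h2 : (univ.filter fun x => ι (σ x) ≤ ι x).card =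
        (univ.filter fun x => ι x ≤ ι (σ x)).card := by
      refine card_bij' (fun x _ => σ x) (fun x _ => σ x) ?_ ?_ ?_ ?_ <;> simp [hinv]
    have h3 := card_union_add_card_inter (univ.filter fun x => ι x ≤ ι (σ x))
      (univ.filter fun x => ι (σ x) ≤ ι x)
    have h4 : (univ.filter fun x => ι x ≤ ι (σ x)) ∩ (univ.filter fun x => ι (σ x) ≤ ι x) =
        univ.filter fun x => σ x = x := by
      ext x
      simp only [mem_inter, mem_filter, mem_univ, true_and]
      exact ⟨fun h => hι _ _ (le_antisymm h.2 h.1), fun h => by simp [h]⟩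
    have h5 := card_le_univ ((univ.filter fun x => ι x ≤ ι (σ x)) ∪
      (univ.filter fun x => ι (σ x) ≤ ι x))
    rw [h4] at h3
    omega
  have hmem : ∀ x, ({x, σ x} : Finset V) ∈ T := fun x => mem_image_of_mem _ (mem_univ x)
  refine ⟨fun x => (T.equivFin ⟨{x, σ x}, hmem x⟩ : ℕ),
    fun x => (Fin.is_lt _).trans_le hcard, fun x y h => ?_⟩
  have h' := T.equivFin.injective (Fin.ext h)
  have h'' : ({x, σ x} : Finset V) = {y, σ y} := congrArg Subtype.val h'
  have hy : y ∈ ({x, σ x} : Finset V) := by rw [h'']; simp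
  simpa using hy

/-- If the bound on the number of colours in `exists_colouring_of_involution` fails for a maximum
matching of `G`, then there is a large set `F` such that few vertices lie outside the set of those
elements of `F` that are isolated from `F`. -/
lemma exists_colouring_or_large_almost_independent (G : SimpleGraph V) (n : ℕ) :
    (∃ (σ : V → V) (φ : V → ℕ), (∀ x, φ x < n) ∧
      (∀ x y, φ x = φ y → y = x ∨ y = σ x) ∧ ∀ x, σ x ≠ x → G.Adj x (σ x)) ∨
    (n < Fintype.card V ∧ ∃ F : Finset V, n < F.card ∧
      (univ.filter fun u => ¬ (u ∈ F ∧ ∀ f ∈ F, ¬ G.Adj u f)).card + 4 * n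
        ≤ 4 * Fintype.card V) := by
  obtain ⟨σ, hinv, hadj, hfix, haug⟩ := exists_involution_without_short_augmenting_path G
  by_cases hn : Fintype.card V + (univ.filter fun x => σ x = x).card ≤ 2 * n
  · obtain ⟨φ, h1, h2⟩ := exists_colouring_of_involution σ hinv n hn
    exact Or.inl ⟨σ, φ, h1, h2, hadj⟩
  right
  let U : Finset V := univ.filter fun x => σ x = x
  let P : Finset V := univ.filter fun x => σ x ≠ x
  let A : Finset V := P.filter fun a => (U.filter fun u => G.Adj a u).card ≤ 1
  have hUP : U.card + P.card = Fintype.card V := by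
    have := card_filter_add_card_filter_not (s := (univ : Finset V)) (fun x => σ x = x)
    simpa [U, P] using this
  change ¬ Fintype.card V + U.card ≤ 2 * n at hn
  have hA : P.card ≤ 2 * A.card := by
    have hsub : P ⊆ A ∪ A.image σ := by
      intro a ha
      have ha' : σ a ≠ a := by simpa [P] using ha
      by_cases hc : (U.filter fun u => G.Adj a u).card ≤ 1
      · exact mem_union_left _ (mem_filter.mpr ⟨ha, hc⟩)
      · refine mem_union_right _ (mem_image.mpr ⟨σ a, mem_filter.mpr ⟨?_, ?_⟩, hinv a⟩)
        · simp only [P, mem_filter, mem_univ, true_and, hinv]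
          exact ha'.symm
        · obtain ⟨u, hu, v, hv, huv⟩ := one_lt_card.mp (not_le.mp hc)
          simp only [U, mem_filter, mem_univ, true_and] at hu hv
          rw [filter_eq_empty_iff.mpr]
          · simp
          · intro w hw hadjw
            have hw' : σ w = w := by simpa [U] using hw
            exact huv ((haug a u w ha' hu.1 hw' hu.2 hadjw).trans
              (haug a v w ha' hv.1 hw' hv.2 hadjw).symm)
    have h1 := card_le_card hsub
    have h2 := card_union_le A (A.image σ)
    have h3 : (A.image σ).card ≤ A.card := card_image_le
    omega
  have hAP : A.card ≤ P.card := card_le_card (filter_subset _ _)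
  have hdisj : Disjoint U A := by
    rw [disjoint_left]
    intro x hx hx'
    simp only [U, A, P, mem_filter, mem_univ, true_and] at hx hx'
    exact hx'.1 hx
  have hFc : (U ∪ A).card = U.card + A.card := card_union_of_disjoint hdisj
  refine ⟨by omega, U ∪ A, by omega, ?_⟩
  have hsub : (univ.filter fun u => ¬ (u ∈ U ∪ A ∧ ∀ f ∈ U ∪ A, ¬ G.Adj u f)) ⊆
      P ∪ A.biUnion fun a => U.filter fun u => G.Adj a u := by
    intro u hu
    simp only [mem_filter, mem_univ, true_and] at hu
    by_cases huf : σ u = u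
    · have huU : u ∈ U := by simpa [U] using huf
      refine mem_union_right _ ?_
      have : ∃ f ∈ U ∪ A, G.Adj u f := by
        by_contra hcon
        push Not at hcon
        exact hu ⟨mem_union_left _ huU, hcon⟩
      obtain ⟨f, hf, huf'⟩ := this
      rcases mem_union.mp hf with hf | hf
      · exact absurd huf' (hfix u f huf (by simpa [U] using hf))
      · exact mem_biUnion.mpr ⟨f, hf, mem_filter.mpr ⟨huU, huf'.symm⟩⟩
    · exact mem_union_left _ (by simpa [P] using huf)
  have h1 := (card_le_card hsub).trans (card_union_le _ _)
  have h2 : (A.biUnion fun a => U.filter fun u => G.Adj a u).card ≤ A.card * 1 :=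
    card_biUnion_le_card_mul _ _ _ fun a ha => (mem_filter.mp ha).2
  omega

end Matching

section Counting

variable {n : ℕ} {H : Finset (Finset (Fin n))}

lemma LinearHG.eq_of_mem_s3 (hH : LinearHG H) {e f : Finset (Fin n)} (he : e ∈ H) (hf : f ∈ H)
    (hef : e ≠ f) {x y : Fin n} (hxe : x ∈ e) (hxf : x ∈ f) (hye : y ∈ e) (hyf : y ∈ f) :
    x = y :=
  card_le_one.mp (hH e he f hf hef) x (mem_inter.mpr ⟨hxe, hxf⟩) y (mem_inter.mpr ⟨hye, hyf⟩)

lemma LinearHG.sum_card_sub_one_le (hH : LinearHG H) (x : Fin n) :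
    ∑ e ∈ H with x ∈ e, ((e.card : ℝ) - 1) ≤ n - 1 := by
  have h1 : ((H.filter fun e => x ∈ e).biUnion fun e => e.erase x).card =
      ∑ e ∈ H with x ∈ e, (e.erase x).card := by
    refine card_biUnion fun e he f hf hef => ?_
    refine disjoint_left.mpr fun y hye hyf => ?_
    have he' := mem_filter.mp he
    have hf' := mem_filter.mp hf
    exact (mem_erase.mp hye).1 (hH.eq_of_mem_s3 he'.1 hf'.1 hef (mem_erase.mp hye).2
      (mem_erase.mp hyf).2 he'.2 hf'.2)
  have h2 : ((H.filter fun e => x ∈ e).biUnion fun e => e.erase x) ⊆ univ.erase x := by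
    intro y hy
    obtain ⟨e, -, hye⟩ := mem_biUnion.mp hy
    exact mem_erase.mpr ⟨(mem_erase.mp hye).1, mem_univ y⟩
  have h3 := card_le_card h2
  rw [h1, card_erase_of_mem (mem_univ x), card_univ, Fintype.card_fin] at h3
  have hn : 1 ≤ n := x.pos
  have h4 : ((∑ e ∈ H with x ∈ e, (e.erase x).card : ℕ) : ℝ) ≤ ((n - 1 : ℕ) : ℝ) :=
    Nat.cast_le.mpr h3
  rw [Nat.cast_sub hn, Nat.cast_sum, Nat.cast_one] at h4
  refine le_trans (le_of_eq (sum_congr rfl fun e he => ?_)) h4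
  have hx := (mem_filter.mp he).2
  rw [card_erase_of_mem hx, Nat.cast_sub (card_pos.mpr ⟨x, hx⟩), Nat.cast_one]

lemma LinearHG.sum_card_mul_card_sub_one_le (hH : LinearHG H) :
    ∑ e ∈ H, (e.card : ℝ) * (e.card - 1) ≤ n * (n - 1) := by
  have h1 : ∑ e ∈ H, (e.card : ℝ) * (e.card - 1) =
      ∑ x : Fin n, ∑ e ∈ H with x ∈ e, ((e.card : ℝ) - 1) := by
    simp_rw [sum_filter]
    rw [sum_comm]
    refine sum_congr rfl fun e _ => ?_
    rw [← sum_filter, sum_const, nsmul_eq_mul, filter_univ_mem]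
  rw [h1]
  refine (sum_le_sum fun x _ => hH.sum_card_sub_one_le x).trans ?_
  rw [sum_const, card_univ, Fintype.card_fin, nsmul_eq_mul]

/-- A vertex outside an edge `u` that meets all edges of `F` has degree at most `|u|` in `F`. -/
lemma LinearHG.degree_le_card (hH : LinearHG H) {F : Finset (Finset (Fin n))} (hF : F ⊆ H)
    {u : Finset (Fin n)} (hu : ∀ f ∈ F, (u ∩ f).Nonempty) {x : Fin n} (hx : x ∉ u) :
    (F.filter fun f => x ∈ f).card ≤ u.card := by
  have : Nonempty (Fin n) := ⟨x⟩
  choose! p hp using hu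
  refine card_le_card_of_injOn p ?_ ?_
  · intro f hf
    exact (mem_inter.mp (hp f (mem_filter.mp hf).1)).1
  · intro f hf g hg hfg
    by_contra hne
    have hf' := mem_filter.mp hf
    have hg' := mem_filter.mp hg
    have hpf := mem_inter.mp (hp f hf'.1)
    have hpg := mem_inter.mp (hp g hg'.1)
    rw [← hfg] at hpg
    have := hH.eq_of_mem_s3 (hF hf'.1) (hF hg'.1) hne hf'.2 hg'.2 hpf.2 hpg.2
    exact hx (this ▸ hpf.1)

lemma card_le_one_add_sum_degree_sub_one {F : Finset (Finset (Fin n))} {u : Finset (Fin n)}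
    (huF : u ∈ F) (hu : ∀ f ∈ F, (u ∩ f).Nonempty) :
    (F.card : ℝ) ≤ 1 + ∑ x ∈ u, (((F.filter fun f => x ∈ f).card : ℝ) - 1) := by
  have h1 : F.erase u ⊆ u.biUnion fun x => (F.filter fun f => x ∈ f).erase u := by
    intro f hf
    obtain ⟨hfu, hfF⟩ := mem_erase.mp hf
    obtain ⟨x, hx⟩ := hu f hfF
    obtain ⟨hxu, hxf⟩ := mem_inter.mp hx
    exact mem_biUnion.mpr ⟨x, hxu, mem_erase.mpr ⟨hfu, mem_filter.mpr ⟨hfF, hxf⟩⟩⟩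
  have h2 := (card_le_card h1).trans card_biUnion_le
  have h3 := card_erase_add_one huF
  have h4 : ((F.erase u).card : ℝ) ≤
      ∑ x ∈ u, (((F.filter fun f => x ∈ f).erase u).card : ℝ) := by exact_mod_cast h2
  have h5 : ((F.erase u).card : ℝ) + 1 = F.card := by exact_mod_cast h3
  have h6 : ∀ x ∈ u, (((F.filter fun f => x ∈ f).erase u).card : ℝ) =
      ((F.filter fun f => x ∈ f).card : ℝ) - 1 := by
    intro x hx
    have := card_erase_add_one (mem_filter.mpr ⟨huF, hx⟩ : u ∈ F.filter fun f => x ∈ f)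
    rw [← this]
    push_cast
    ring
  rw [sum_congr rfl h6] at h4
  linarith

/-- How far the number of ordered pairs in `e` falls short of `n - 1`. -/
noncomputable def deficiency (e : Finset (Fin n)) : ℝ := (n - 1) - (e.card : ℝ) * (e.card - 1)

lemma deficiency_le {s : ℝ} (hs : s ^ 2 = n) (hs' : 1000 ≤ s) {e : Finset (Fin n)}
    (he : 99 / 100 * s ≤ e.card) : deficiency e ≤ 3 / 100 * n := by
  unfold deficiency
  rw [← hs]
  nlinarith

lemma card_le_of_deficiency_pos {s : ℝ} (hs : s ^ 2 = n) (hs' : 1000 ≤ s)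
    {e : Finset (Fin n)} (he : 0 < deficiency e) : (e.card : ℝ) ≤ s + 1 / 2 := by
  unfold deficiency at he
  rw [← hs] at he
  nlinarith

lemma LinearHG.degree_le (hH : LinearHG H) {s : ℝ} (hs : s ^ 2 = n) (hs' : 1000 ≤ s)
    (hsize : ∀ e ∈ H, 99 / 100 * s ≤ e.card) (x : Fin n) :
    ((H.filter fun e => x ∈ e).card : ℝ) ≤ 102 / 100 * s := by
  have h1 := hH.sum_card_sub_one_le x
  have h2 : ((H.filter fun e => x ∈ e).card : ℝ) * (985 / 1000 * s) ≤ n - 1 := by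
    refine le_trans ?_ h1
    rw [← nsmul_eq_mul]
    refine card_nsmul_le_sum _ _ _ fun e he => ?_
    have := hsize e (mem_filter.mp he).1
    linarith
  rw [← hs] at h2
  nlinarith

/-- Edges of positive deficiency meeting more than `n` edges have small total deficiency. -/
lemma LinearHG.sum_deficiency_le (hH : LinearHG H) {s : ℝ} (hs : s ^ 2 = n) (hs' : 1000 ≤ s)
    (hsize : ∀ e ∈ H, 99 / 100 * s ≤ e.card) {F W : Finset (Finset (Fin n))} (hF : F ⊆ H)
    (hFn : n < F.card) (hWF : W ⊆ F) (hW : ∀ u ∈ W, ∀ f ∈ F, (u ∩ f).Nonempty)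
    (hpos : ∀ u ∈ W, 0 < deficiency u) :
    ∑ u ∈ W, deficiency u ≤ 1 / 10 * n := by
  have hn0 : (0 : ℝ) ≤ n := Nat.cast_nonneg n
  rcases le_or_gt W.card 1 with hW1 | hW1
  · have h1 : ∑ u ∈ W, deficiency u ≤ W.card • (3 / 100 * (n : ℝ)) :=
      sum_le_card_nsmul _ _ _ fun u hu => deficiency_le hs hs' (hsize u (hF (hWF hu)))
    rw [nsmul_eq_mul] at h1
    have h2 : (W.card : ℝ) ≤ 1 := by exact_mod_cast hW1
    nlinarith
  have hdeg : ∀ x, (∃ u ∈ W, x ∉ u) →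
      ((F.filter fun f => x ∈ f).card : ℝ) - 1 ≤ s - 1 / 2 := by
    rintro x ⟨u, hu, hx⟩
    have h1 : ((F.filter fun f => x ∈ f).card : ℝ) ≤ u.card := by
      exact_mod_cast hH.degree_le_card hF (hW u hu) hx
    have h2 := card_le_of_deficiency_pos hs hs' (hpos u hu)
    linarith
  have hFn' : s ^ 2 + 1 ≤ (F.card : ℝ) := by
    rw [hs]
    exact_mod_cast hFn
  by_cases hcommon : ∃ x, ∀ u ∈ W, x ∈ u
  · obtain ⟨x₀, hx₀⟩ := hcommon
    have hd₀ := hH.degree_le hs hs' hsize x₀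
    have hother : ∀ x, x ≠ x₀ → ∃ u ∈ W, x ∉ u := by
      intro x hx
      by_contra hcon
      push Not at hcon
      obtain ⟨u, hu, v, hv, huv⟩ := one_lt_card.mp hW1
      exact hx (hH.eq_of_mem_s3 (hF (hWF hu)) (hF (hWF hv)) huv (hcon u hu) (hcon v hv)
        (hx₀ u hu) (hx₀ v hv))
    have hdF : ((F.filter fun f => x₀ ∈ f).card : ℝ) ≤ 102 / 100 * s :=
      le_trans (by exact_mod_cast card_le_card (filter_subset_filter _ hF)) hd₀
    have hWc : (W.card : ℝ) ≤ 102 / 100 * s := by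
      refine le_trans ?_ hdF
      have : W ⊆ F.filter fun f => x₀ ∈ f := fun u hu =>
        mem_filter.mpr ⟨hWF hu, hx₀ u hu⟩
      exact_mod_cast card_le_card this
    have hdef : ∀ u ∈ W, deficiency u ≤ 6 / 100 * s := by
      intro u hu
      have h1 := card_le_one_add_sum_degree_sub_one (hWF hu) (hW u hu)
      rw [← add_sum_erase u _ (hx₀ u hu)] at h1
      have h2 : ∑ x ∈ u.erase x₀, (((F.filter fun f => x ∈ f).card : ℝ) - 1) ≤
          (u.erase x₀).card • (s - 1 / 2) :=
        sum_le_card_nsmul _ _ _ fun x hx => hdeg x (hother x (mem_erase.mp hx).1)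
      have h3 : ((u.erase x₀).card : ℝ) = u.card - 1 := by
        rw [← card_erase_add_one (hx₀ u hu)]
        push_cast
        ring
      rw [nsmul_eq_mul, h3] at h2
      have h4 : s - 53 / 100 ≤ (u.card : ℝ) - 1 := by
        by_contra hcon
        push Not at hcon
        nlinarith
      unfold deficiency
      rw [← hs]
      nlinarith
    have h1 := sum_le_card_nsmul _ _ _ hdef
    rw [nsmul_eq_mul] at h1
    rw [← hs]
    nlinarith
  · push Not at hcommon
    exfalso
    obtain ⟨u, hu⟩ := card_pos.mp (zero_lt_one.trans hW1)
    have h1 := card_le_one_add_sum_degree_sub_one (hWF hu) (hW u hu)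
    have h2 : ∑ x ∈ u, (((F.filter fun f => x ∈ f).card : ℝ) - 1) ≤ u.card • (s - 1 / 2) :=
      sum_le_card_nsmul _ _ _ fun x _ => hdeg x (hcommon x)
    have h3 := card_le_of_deficiency_pos hs hs' (hpos u hu)
    rw [nsmul_eq_mul] at h2
    nlinarith

lemma LinearHG.false_of_almost_intersecting (hH : LinearHG H) {s : ℝ} (hs : s ^ 2 = n)
    (hs' : 1000 ≤ s) (hsize : ∀ e ∈ H, 99 / 100 * s ≤ e.card) (hn : n < H.card)
    {F : Finset (Finset (Fin n))} (hF : F ⊆ H) (hFn : n < F.card)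
    (hbad : (H.filter fun u => ¬ (u ∈ F ∧ ∀ f ∈ F, (u ∩ f).Nonempty)).card + 4 * n
      ≤ 4 * H.card) : False := by
  have hn0 : (1000000 : ℝ) ≤ n := by
    rw [← hs]
    nlinarith
  have hlower : ((H.card : ℝ) - n) * (n - 1) ≤ ∑ e ∈ H, deficiency e := by
    have := hH.sum_card_mul_card_sub_one_le
    simp only [deficiency, sum_sub_distrib, sum_const, nsmul_eq_mul]
    linarith
  let good : Finset (Fin n) → Prop := fun u => u ∈ F ∧ ∀ f ∈ F, (u ∩ f).Nonempty
  have hsplit := sum_filter_add_sum_filter_not H good deficiency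
  have hgood : ∑ e ∈ H with good e, deficiency e ≤ 1 / 10 * n := by
    have h1 : ∑ e ∈ H with good e, deficiency e ≤
        ∑ e ∈ (H.filter good).filter (fun e => 0 < deficiency e), deficiency e := by
      rw [← sum_filter_add_sum_filter_not (H.filter good) (fun e => 0 < deficiency e)]
      have : ∑ e ∈ (H.filter good).filter (fun e => ¬ 0 < deficiency e), deficiency e ≤ 0 :=
        sum_nonpos fun e he => not_lt.mp (mem_filter.mp he).2
      linarith
    refine h1.trans (hH.sum_deficiency_le hs hs' hsize hF hFn ?_ ?_ ?_)
    · intro u hu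
      exact (mem_filter.mp (mem_filter.mp hu).1).2.1
    · intro u hu
      exact (mem_filter.mp (mem_filter.mp hu).1).2.2
    · intro u hu
      exact (mem_filter.mp hu).2
  have hrest : ∑ e ∈ H with ¬ good e, deficiency e ≤
      (H.filter fun e => ¬ good e).card • (3 / 100 * (n : ℝ)) :=
    sum_le_card_nsmul _ _ _ fun u hu => deficiency_le hs hs' (hsize u (mem_filter.mp hu).1)
  rw [nsmul_eq_mul] at hrest
  have hbad' : ((H.filter fun e => ¬ good e).card : ℝ) + 4 * n ≤ 4 * H.card := by
    exact_mod_cast hbad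
  have ht : (n : ℝ) + 1 ≤ H.card := by exact_mod_cast hn
  nlinarith [mul_le_mul_of_nonneg_right hbad' (by positivity : (0 : ℝ) ≤ 3 / 100 * n),
    mul_le_mul_of_nonneg_right ht (by linarith : (0 : ℝ) ≤ n)]

end Counting

/-- Edges of `H`, adjacent when they are disjoint and distinct. -/
def disjointnessGraph {n : ℕ} (H : Finset (Finset (Fin n))) : SimpleGraph H where
  Adj e f := e ≠ f ∧ ¬ (e.1 ∩ f.1).Nonempty
  symm := ⟨fun e f h => ⟨h.1.symm, by rw [inter_comm]; exact h.2⟩⟩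
  loopless := ⟨fun _ h => h.1 rfl⟩

/-- If every edge of an `n`-vertex linear hypergraph has size at least `(1-δ)√n` (for a
sufficiently small `δ` and sufficiently large `n`), then `H` has a proper edge-colouring with
`n` colours in which each colour is used at most twice. -/
theorem colouring_of_FPP_extremal_hypergraphs :
    ∃ δ0 : ℝ, 0 < δ0 ∧ δ0 < 1 ∧
      ∀ δ : ℝ, 0 < δ → δ ≤ δ0 →
        ∃ n0 : ℕ, ∀ n : ℕ, n0 ≤ n → ∀ H : Finset (Finset (Fin n)),
          (∀ e ∈ H, e.Nonempty) → LinearHG H →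
          (∀ e ∈ H, (1 - δ) * Real.sqrt n ≤ (e.card : ℝ)) →
          ∃ φ : Finset (Fin n) → ℕ,
            (∀ e ∈ H, φ e < n) ∧ IsProperEC H φ ∧ ColoursUsedAtMostTwice H φ := by
  refine ⟨1 / 100, by norm_num, by norm_num, fun δ hδ hδ0 => ⟨1000000, ?_⟩⟩
  intro n hn H hne hH hsize
  have hs : Real.sqrt n ^ 2 = n := Real.sq_sqrt (Nat.cast_nonneg n)
  have hs' : 1000 ≤ Real.sqrt n := by
    refine Real.le_sqrt_of_sq_le ?_
    norm_num
    exact_mod_cast hn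
  have hsize' : ∀ e ∈ H, 99 / 100 * Real.sqrt n ≤ e.card := by
    intro e he
    have := hsize e he
    nlinarith
  rcases exists_colouring_or_large_almost_independent (disjointnessGraph H) n with h | h
  · obtain ⟨σ, φ, hlt, hφ, hadj⟩ := h
    refine ⟨fun e => if h : e ∈ H then φ ⟨e, h⟩ else 0, ?_, ?_, ?_⟩
    · intro e he
      simpa [he] using hlt ⟨e, he⟩
    · intro e he f hf hef hint heq
      simp only [he, hf, dite_true] at heq
      rcases hφ _ _ heq with h | h
      · exact hef (congrArg Subtype.val h).symm
      · have hne' : σ ⟨e, he⟩ ≠ ⟨e, he⟩ := by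
          rw [← h]
          exact fun h' => hef (congrArg Subtype.val h').symm
        have := (hadj _ hne').2
        rw [← h] at this
        exact this hint
    · intro c
      rcases (H.filter fun e => (if h : e ∈ H then φ ⟨e, h⟩ else 0) = c).eq_empty_or_nonempty
        with h0 | ⟨e, he⟩
      · rw [h0]
        simp
      · obtain ⟨heH, hec⟩ := mem_filter.mp he
        simp only [heH, dite_true] at hec
        refine le_trans (card_le_card (t := {e, (σ ⟨e, heH⟩).1}) ?_) card_le_two
        intro f hf
        obtain ⟨hfH, hfc⟩ := mem_filter.mp hf
        simp only [hfH, dite_true] at hfc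
        rcases hφ ⟨e, heH⟩ ⟨f, hfH⟩ (hec.trans hfc.symm) with h | h
        · exact mem_insert.mpr (Or.inl (congrArg Subtype.val h))
        · exact mem_insert_of_mem (mem_singleton.mpr (congrArg Subtype.val h))
  · exfalso
    obtain ⟨hcard, F, hFn, hbad⟩ := h
    rw [Fintype.card_coe] at hcard hbad
    let F' : Finset (Finset (Fin n)) := F.map (Function.Embedding.subtype _)
    have hF' : F' ⊆ H := by
      intro f hf
      obtain ⟨g, -, rfl⟩ := mem_map.mp hf
      exact g.2
    refine hH.false_of_almost_intersecting hs hs' hsize' hcard hF' (by simpa [F'] using hFn) ?_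
    refine le_trans (Nat.add_le_add_right ?_ _) hbad
    rw [← card_map (Function.Embedding.subtype _)]
    refine card_le_card fun u hu => ?_
    obtain ⟨huH, hu⟩ := mem_filter.mp hu
    refine mem_map.mpr ⟨⟨u, huH⟩, mem_filter.mpr ⟨mem_univ _, fun hgood => hu ⟨?_, ?_⟩⟩, rfl⟩
    · exact mem_map.mpr ⟨_, hgood.1, rfl⟩
    · intro f hf
      obtain ⟨g, hg, rfl⟩ := mem_map.mp hf
      by_contra hcon
      by_cases hug : (⟨u, huH⟩ : H) = g
      · subst hug
        exact hcon (by simpa using hne u huH)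
      · exact hgood.2 g hg ⟨hug, hcon⟩
end
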